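/- arXiv:2305.12614 — 3 statements merged into one kernel-verified Lean document; each statement's English description precedes it below -/
import Mathlib

section
/- In the TIP alternating-interaction model with m ≥ 1 and n ≥ 0, set Ŝ^x = n·t^{xy}·ŝ^x, F̂^x = n·t^{xy}·f̂^x, S^x = m·s^x·r, F^x = m·f^x·r̄, Ŝ^y = m·t^{yx}·ŝ^y, F̂^y = m·t^{yx}·f̂^y, S^y = n·s^y·r, F^y = n·f^y·r̄. If S^x·F^y < F^x·S^y, then the in-probability limits t^x and t^y of the trust processes T^x_k and T^y_k satisfy the system F^x·t^x/(1−t^x) = Ŝ^x·(t^y − t^x) + S^x and S^y·(1−t^y)/t^y = F̂^y·(t^y − t^x) + F^y. -/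
open MeasureTheory Filter

/-- The Beta(a,b) probability measure on ℝ: the measure supported on (0,1) with density
`x ↦ x^(a−1)·(1−x)^(b−1) / B(a,b)` with respect to Lebesgue measure, where
`B(a,b) = Γ(a)·Γ(b)/Γ(a+b)`. -/
noncomputable def betaMeasure (a b : ℝ) : Measure ℝ :=
  volume.withDensity fun x =>
    ENNReal.ofReal
      (if 0 < x ∧ x < 1 then
        x ^ (a - 1) * (1 - x) ^ (b - 1) / (Real.Gamma a * Real.Gamma b / Real.Gamma (a + b))
      else 0)


/-- density -/
lemma tip_pdf_integrable {a b : ℝ} (ha : 0 < a) (hb : 0 < b) :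
    Integrable (ProbabilityTheory.betaPDFReal a b) ∧
      ∫ x, ProbabilityTheory.betaPDFReal a b x = 1 := by
  have hnn : ∀ x, 0 ≤ ProbabilityTheory.betaPDFReal a b x := by
    intro x
    by_cases h : 0 < x ∧ x < 1
    · exact (ProbabilityTheory.betaPDFReal_pos h.1 h.2 ha hb).le
    · simp [ProbabilityTheory.betaPDFReal, h]
  have h1 := ProbabilityTheory.lintegral_betaPDF_eq_one ha hb
  unfold ProbabilityTheory.betaPDF at h1
  constructor
  · refine ⟨(ProbabilityTheory.stronglyMeasurable_betaPDFReal a b).aestronglyMeasurable, ?_⟩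
    rw [hasFiniteIntegral_iff_ofReal (Eventually.of_forall hnn), h1]
    simp
  · rw [integral_eq_lintegral_of_nonneg_ae (Eventually.of_forall hnn)
      (ProbabilityTheory.stronglyMeasurable_betaPDFReal a b).aestronglyMeasurable, h1]
    simp

lemma tip_pdf_mul {a b : ℝ} (ha : 0 < a) (hb : 0 < b) (x : ℝ) :
    x * ProbabilityTheory.betaPDFReal a b x =
      (a / (a + b)) * ProbabilityTheory.betaPDFReal (a + 1) b x := by
  unfold ProbabilityTheory.betaPDFReal
  split_ifs with h
  · have e1 : x ^ (a + 1 - 1) = x * x ^ (a - 1) := by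
      rw [show a + 1 - 1 = (a - 1) + 1 by ring, Real.rpow_add_one h.1.ne']; ring
    rw [e1]
    unfold ProbabilityTheory.beta
    rw [show a + 1 + b = (a + b) + 1 by ring, Real.Gamma_add_one ha.ne',
      Real.Gamma_add_one (add_pos ha hb).ne']
    have h1 := (Real.Gamma_pos_of_pos ha).ne'
    have h2 := (Real.Gamma_pos_of_pos hb).ne'
    have h3 := (Real.Gamma_pos_of_pos (add_pos ha hb)).ne'
    have h4 : a + b ≠ 0 := (add_pos ha hb).ne'
    field_simp
  · simp

lemma tip_beta_eq (a b : ℝ) : betaMeasure a b =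
    volume.withDensity (fun x => ENNReal.ofReal (ProbabilityTheory.betaPDFReal a b x)) := by
  unfold betaMeasure
  congr 1
  funext x
  unfold ProbabilityTheory.betaPDFReal ProbabilityTheory.beta
  congr 1
  split_ifs
  · ring
  · rfl

lemma tip_beta_prob {a b : ℝ} (ha : 0 < a) (hb : 0 < b) : IsProbabilityMeasure (betaMeasure a b) := by
  rw [tip_beta_eq]
  exact ProbabilityTheory.isProbabilityMeasureBeta ha hb

lemma tip_beta_Icc (a b : ℝ) :
    betaMeasure a b (Set.Icc 0 1)ᶜ = 0 := by
  rw [tip_beta_eq, withDensity_apply _ measurableSet_Icc.compl]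
  refine setLIntegral_eq_zero measurableSet_Icc.compl ?_
  intro x hx
  have : ¬ (0 < x ∧ x < 1) := fun h => hx ⟨h.1.le, h.2.le⟩
  simp [ProbabilityTheory.betaPDFReal, this]

lemma tip_beta_bound {a b : ℝ} (ha : 0 < a) (hb : 0 < b) (ρ ε : ℝ) (hε : 0 < ε) :
    (betaMeasure a b {x | ε < |x - ρ|}).toReal ≤
      (1 / (a + b) + (a / (a + b) - ρ) ^ 2) / ε ^ 2 := by
  have hS : MeasurableSet {x : ℝ | ε < |x - ρ|} :=
    measurableSet_lt measurable_const (by fun_prop)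
  set f := ProbabilityTheory.betaPDFReal a b with hf
  have hnn : ∀ x, 0 ≤ f x := by
    intro x
    by_cases h : 0 < x ∧ x < 1
    · exact (ProbabilityTheory.betaPDFReal_pos h.1 h.2 ha hb).le
    · simp [hf, ProbabilityTheory.betaPDFReal, h]
  obtain ⟨i0, e0⟩ := tip_pdf_integrable ha hb
  obtain ⟨i1, e1⟩ := tip_pdf_integrable (show 0 < a + 1 by linarith) hb
  obtain ⟨i2, e2⟩ := tip_pdf_integrable (show 0 < a + 1 + 1 by linarith) hb
  have hexp : ∀ x, (x - ρ) ^ 2 * f x =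
      (a / (a + b)) * ((a + 1) / (a + 1 + b)) * ProbabilityTheory.betaPDFReal (a + 1 + 1) b x
      + (-2 * ρ * (a / (a + b))) * ProbabilityTheory.betaPDFReal (a + 1) b x + ρ ^ 2 * f x := by
    intro x
    have h1 := tip_pdf_mul ha hb x
    have h2 := tip_pdf_mul (show 0 < a + 1 by linarith) hb x
    rw [← hf] at h1
    linear_combination (x - 2 * ρ) * h1 + (a / (a + b)) * h2
  have hint : Integrable (fun x => (x - ρ) ^ 2 * f x) := by
    simp_rw [hexp]
    exact ((i2.const_mul _).add (i1.const_mul _)).add (i0.const_mul _)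
  have hval : ∫ x, (x - ρ) ^ 2 * f x =
      (a / (a + b)) * ((a + 1) / (a + 1 + b)) + (-2 * ρ * (a / (a + b))) + ρ ^ 2 := by
    simp_rw [hexp]
    rw [integral_add, integral_add, integral_const_mul, integral_const_mul,
      integral_const_mul, e0, e1, e2]
    · ring
    · exact i2.const_mul _
    · exact i1.const_mul _
    · exact (i2.const_mul _).add (i1.const_mul _)
    · exact i0.const_mul _
  have hm : (betaMeasure a b {x | ε < |x - ρ|}).toReal = ∫ x in {x | ε < |x - ρ|}, f x := by
    rw [tip_beta_eq, withDensity_apply _ hS, integral_eq_lintegral_of_nonneg_ae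
      (Eventually.of_forall hnn) i0.aestronglyMeasurable.restrict]
  rw [hm, le_div_iff₀ (by positivity)]
  calc (∫ x in {x | ε < |x - ρ|}, f x) * ε ^ 2
      = ∫ x in {x | ε < |x - ρ|}, f x * ε ^ 2 := (integral_mul_const _ _).symm
    _ ≤ ∫ x in {x | ε < |x - ρ|}, (x - ρ) ^ 2 * f x := by
        refine setIntegral_mono_on (i0.mul_const _).integrableOn hint.integrableOn hS ?_
        intro x hx
        have : ε ^ 2 ≤ (x - ρ) ^ 2 := by
          rw [← sq_abs (x - ρ)]
          exact pow_le_pow_left₀ hε.le (le_of_lt hx) 2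
        rw [mul_comm]
        exact mul_le_mul_of_nonneg_right this (hnn x)
    _ ≤ ∫ x, (x - ρ) ^ 2 * f x :=
        setIntegral_le_integral hint (Eventually.of_forall fun x => mul_nonneg (sq_nonneg _) (hnn x))
    _ ≤ _ := by
        rw [hval]
        have hab : 0 < a + b := by linarith
        have h1 : (a / (a + b)) * ((a + 1) / (a + 1 + b)) ≤ 1 / (a + b) + (a / (a + b)) ^ 2 := by
          have : 1 / (a + b) + (a / (a + b)) ^ 2 - (a / (a + b)) * ((a + 1) / (a + 1 + b))
            = ((a + b) * (a + 1 + b) - a * b) / ((a + b) ^ 2 * (a + 1 + b)) := by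
            field_simp
            ring
          have h2 : 0 ≤ ((a + b) * (a + 1 + b) - a * b) / ((a + b) ^ 2 * (a + 1 + b)) := by
            apply div_nonneg
            · nlinarith [mul_pos ha hb]
            · positivity
          linarith
        nlinarith [h1]

lemma tip_law_prob {Ω : Type*} {m0 : MeasurableSpace Ω} (P : Measure Ω) [IsProbabilityMeasure P]
    (a b T : Ω → ℝ) (hT : Measurable T) (G : MeasurableSpace Ω) (hG : G ≤ m0)
    (S : Set ℝ) (hS : MeasurableSet S)
    (hlaw : P[fun ω => S.indicator (fun _ => (1 : ℝ)) (T ω) | G]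
        =ᵐ[P] fun ω => (betaMeasure (a ω) (b ω) S).toReal) :
    (P (T ⁻¹' S)).toReal = ∫ ω, (betaMeasure (a ω) (b ω) S).toReal ∂P := by
  rw [← integral_congr_ae hlaw, integral_condExp hG]
  have : (fun ω => S.indicator (fun _ => (1 : ℝ)) (T ω)) = (T ⁻¹' S).indicator (fun _ => 1) := by
    funext ω
    by_cases h : T ω ∈ S
    · rw [Set.indicator_of_mem h, Set.indicator_of_mem (show ω ∈ T ⁻¹' S from h)]
    · rw [Set.indicator_of_notMem h, Set.indicator_of_notMem (show ω ∉ T ⁻¹' S from h)]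
  rw [this]
  change _ = ∫ ω, (T ⁻¹' S).indicator (fun _ => (1 : ℝ)) ω ∂P
  rw [integral_indicator_const _ (hT hS)]
  simp [Measure.real]

lemma tip_law_Icc {Ω : Type*} {m0 : MeasurableSpace Ω} (P : Measure Ω) [IsProbabilityMeasure P]
    (a b T : Ω → ℝ) (hT : Measurable T) (G : MeasurableSpace Ω) (hG : G ≤ m0)
    (hlaw : ∀ S : Set ℝ, MeasurableSet S → P[fun ω => S.indicator (fun _ => (1 : ℝ)) (T ω) | G]
        =ᵐ[P] fun ω => (betaMeasure (a ω) (b ω) S).toReal) :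
    ∀ᵐ ω ∂P, T ω ∈ Set.Icc (0 : ℝ) 1 := by
  have h := tip_law_prob P a b T hT G hG (Set.Icc 0 1)ᶜ measurableSet_Icc.compl
    (hlaw _ measurableSet_Icc.compl)
  simp only [tip_beta_Icc, ENNReal.toReal_zero, integral_zero] at h
  rw [ENNReal.toReal_eq_zero_iff] at h
  have h := h.resolve_right (measure_ne_top _ _)
  exact h

lemma tip_concentration {Ω : Type*} {m0 : MeasurableSpace Ω} (P : Measure Ω)
    [IsProbabilityMeasure P] (G : ℕ → MeasurableSpace Ω) (hG : ∀ q, G q ≤ m0)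
    (a b T : ℕ → Ω → ℝ) (hT : ∀ q, Measurable (T q))
    (ha : ∀ q ω, 0 < a q ω) (hb : ∀ q ω, 0 < b q ω)
    (hlaw : ∀ q, ∀ S : Set ℝ, MeasurableSet S →
      P[fun ω => S.indicator (fun _ => (1 : ℝ)) (T q ω) | G q]
        =ᵐ[P] fun ω => (betaMeasure (a q ω) (b q ω) S).toReal)
    (A B : ℝ) (hA : 0 < A) (hB : 0 < B)
    (hal : TendstoInMeasure P (fun (q : ℕ) ω => a q ω / q) atTop (fun _ => A))
    (hbl : TendstoInMeasure P (fun (q : ℕ) ω => b q ω / q) atTop (fun _ => B))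
    (t : ℝ) (ht : ∀ ε > 0, Tendsto (fun q => P {ω | ε < |T q ω - t|}) atTop (nhds 0)) :
    t = A / (A + B) := by
  set ρ := A / (A + B) with hρ
  have hAB : 0 < A + B := by linarith
  obtain ⟨φ, hφ, hφa⟩ := hal.exists_seq_tendsto_ae
  obtain ⟨ψ, hψ, hψb⟩ := (hbl.comp hφ.tendsto_atTop).exists_seq_tendsto_ae
  have hθ : Tendsto (fun i => φ (ψ i)) atTop atTop := hφ.tendsto_atTop.comp hψ.tendsto_atTop
  by_contra hne
  set ε := |t - ρ| / 3 with hεd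
  have hε : 0 < ε := by
    have : 0 < |t - ρ| := abs_pos.mpr (sub_ne_zero.mpr hne)
    positivity
  have hS : MeasurableSet {x : ℝ | ε < |x - ρ|} :=
    measurableSet_lt measurable_const (by fun_prop)
  have key : Tendsto (fun i => ∫ ω, (betaMeasure (a (φ (ψ i)) ω) (b (φ (ψ i)) ω)
      {x : ℝ | ε < |x - ρ|}).toReal ∂P) atTop (nhds (∫ _, (0 : ℝ) ∂P)) := by
    refine tendsto_integral_of_dominated_convergence (fun _ => 1) ?_ (integrable_const _) ?_ ?_
    · intro i
      exact (integrable_condExp.aestronglyMeasurable).congr (hlaw _ _ hS)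
    · intro i
      refine Eventually.of_forall fun ω => ?_
      have := tip_beta_prob (ha (φ (ψ i)) ω) (hb (φ (ψ i)) ω)
      rw [Real.norm_of_nonneg ENNReal.toReal_nonneg]
      exact measureReal_le_one
    · filter_upwards [hφa, hψb] with ω h1 h2
      have h1 : Tendsto (fun i => a (φ (ψ i)) ω / (φ (ψ i) : ℝ)) atTop (nhds A) :=
        h1.comp hψ.tendsto_atTop
      have h2 : Tendsto (fun i => b (φ (ψ i)) ω / (φ (ψ i) : ℝ)) atTop (nhds B) := h2
      have hc : Tendsto (fun i => (φ (ψ i) : ℝ)) atTop atTop :=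
        tendsto_natCast_atTop_atTop.comp hθ
      have hpos : ∀ᶠ i in atTop, (0 : ℝ) < (φ (ψ i) : ℝ) := hc.eventually_gt_atTop 0
      have h3 : Tendsto (fun i => a (φ (ψ i)) ω / (a (φ (ψ i)) ω + b (φ (ψ i)) ω)) atTop
          (nhds ρ) := by
        refine (h1.div (h1.add h2) hAB.ne').congr' ?_
        filter_upwards [hpos] with i hi
        have := add_pos (ha (φ (ψ i)) ω) (hb (φ (ψ i)) ω)
        simp only [Pi.div_apply]
        field_simp
      have h4 : Tendsto (fun i => 1 / (a (φ (ψ i)) ω + b (φ (ψ i)) ω)) atTop (nhds 0) := by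
        have h5 : Tendsto (fun i => a (φ (ψ i)) ω + b (φ (ψ i)) ω) atTop atTop := by
          refine (Tendsto.atTop_mul_pos hAB hc (h1.add h2)).congr' ?_
          filter_upwards [hpos] with i hi
          field_simp
        simp only [one_div]
        exact h5.inv_tendsto_atTop
      have h6 : Tendsto (fun i => (1 / (a (φ (ψ i)) ω + b (φ (ψ i)) ω) +
          (a (φ (ψ i)) ω / (a (φ (ψ i)) ω + b (φ (ψ i)) ω) - ρ) ^ 2) / ε ^ 2) atTop (nhds 0) := by
        have := (h4.add ((h3.sub_const ρ).pow 2)).div_const (ε ^ 2)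
        simpa using this
      exact squeeze_zero (fun i => ENNReal.toReal_nonneg)
        (fun i => tip_beta_bound (ha _ ω) (hb _ ω) ρ ε hε) h6
  have key2 : Tendsto (fun i => (P {ω | ε < |T (φ (ψ i)) ω - ρ|}).toReal) atTop (nhds 0) := by
    simp only [integral_zero] at key
    refine key.congr fun i => ?_
    exact (tip_law_prob P _ _ (T (φ (ψ i))) (hT _) (G _) (hG _) _ hS (hlaw _ _ hS)).symm
  have key3 : Tendsto (fun i => (P {ω | ε < |T (φ (ψ i)) ω - t|}).toReal) atTop (nhds 0) := by
    have h0 := (ENNReal.tendsto_toReal (ENNReal.zero_ne_top)).comp ((ht ε hε).comp hθ)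
    rw [ENNReal.toReal_zero] at h0
    exact h0
  have hsum := key2.add key3
  have hge : ∀ i, (1 : ℝ) ≤ (P {ω | ε < |T (φ (ψ i)) ω - ρ|}).toReal +
      (P {ω | ε < |T (φ (ψ i)) ω - t|}).toReal := by
    intro i
    have hun : {ω | ε < |T (φ (ψ i)) ω - ρ|} ∪ {ω | ε < |T (φ (ψ i)) ω - t|} = Set.univ := by
      ext ω
      simp only [Set.mem_union, Set.mem_ofPred_eq, Set.mem_univ, iff_true]
      by_contra hcon
      push Not at hcon
      have h1 := abs_sub_le t (T (φ (ψ i)) ω) ρ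
      rw [abs_sub_comm t (T (φ (ψ i)) ω)] at h1
      linarith [hcon.1, hcon.2]
    have := measureReal_union_le (μ := P) {ω | ε < |T (φ (ψ i)) ω - ρ|}
      {ω | ε < |T (φ (ψ i)) ω - t|}
    rw [hun] at this
    simpa [Measure.real] using this
  have := ge_of_tendsto' hsum hge
  norm_num at this

/-- bounded convergence in probability gives convergence in mean -/
lemma tip_L1 {Ω : Type*} {m0 : MeasurableSpace Ω} (P : Measure Ω) [IsProbabilityMeasure P]
    (T : ℕ → Ω → ℝ) (hT : ∀ k, Measurable (T k))
    (hb : ∀ k, 1 ≤ k → ∀ᵐ ω ∂P, T k ω ∈ Set.Icc (0 : ℝ) 1)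
    (t : ℝ) (ht : ∀ ε > 0, Tendsto (fun q => P {ω | ε < |T q ω - t|}) atTop (nhds 0)) :
    (∀ k, 1 ≤ k → Integrable (fun ω => |T k ω - t|) P) ∧
      Tendsto (fun k => ∫ ω, |T k ω - t| ∂P) atTop (nhds 0) := by
  have hM : ∀ k, 1 ≤ k → ∀ᵐ ω ∂P, |T k ω - t| ≤ 1 + |t| := by
    intro k hk
    filter_upwards [hb k hk] with ω hω
    have := abs_sub (T k ω) t
    rw [abs_of_nonneg hω.1] at this
    linarith [hω.2]
  have hint : ∀ k, 1 ≤ k → Integrable (fun ω => |T k ω - t|) P := by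
    intro k hk
    refine Integrable.of_bound (((hT k).sub_const t).abs.aestronglyMeasurable) (1 + |t|) ?_
    filter_upwards [hM k hk] with ω hω
    simpa using hω
  refine ⟨hint, ?_⟩
  rw [Metric.tendsto_atTop]
  intro ε hε
  have h1 : Tendsto (fun k => (1 + |t|) * (P {ω | ε / 2 < |T k ω - t|}).toReal) atTop
      (nhds ((1 + |t|) * 0)) := by
    refine Tendsto.const_mul _ ?_
    have h0 := (ENNReal.tendsto_toReal (ENNReal.zero_ne_top)).comp (ht (ε / 2) (by linarith))
    rw [ENNReal.toReal_zero] at h0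
    exact h0
  rw [mul_zero] at h1
  obtain ⟨K, hK⟩ := eventually_atTop.1 (h1.eventually_lt_const (show (0 : ℝ) < ε / 2 by linarith))
  refine ⟨max K 1, fun k hk => ?_⟩
  have hk1 : 1 ≤ k := le_trans (le_max_right _ _) hk
  have hkK : K ≤ k := le_trans (le_max_left _ _) hk
  rw [Real.dist_eq, sub_zero, abs_of_nonneg (integral_nonneg fun ω => abs_nonneg _)]
  have hSm : MeasurableSet {ω | ε / 2 < |T k ω - t|} :=
    measurableSet_lt measurable_const ((hT k).sub_const t).abs
  calc ∫ ω, |T k ω - t| ∂P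
      ≤ ∫ ω, (ε / 2 + {ω | ε / 2 < |T k ω - t|}.indicator (fun _ => 1 + |t|) ω) ∂P := by
        refine integral_mono_ae (hint k hk1)
          ((integrable_const _).add ((integrable_const _).indicator hSm)) ?_
        filter_upwards [hM k hk1] with ω hω
        by_cases h : ε / 2 < |T k ω - t|
        · rw [Set.indicator_of_mem (by exact h)]; linarith
        · rw [Set.indicator_of_notMem (by exact h)]; linarith
    _ = ε / 2 + (1 + |t|) * (P {ω | ε / 2 < |T k ω - t|}).toReal := by
        rw [integral_add (integrable_const _) ((integrable_const _).indicator hSm),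
          integral_indicator_const _ hSm]
        simp [Measure.real, mul_comm]
    _ < ε := by linarith [hK k hkK]

lemma tip_sum_periodic (m n : ℕ) (u v : ℝ) (c : ℕ) :
    ∑ j ∈ Finset.range (m + n), (if (c + j) % (m + n) < m then u else v) = m * u + n * v := by
  induction c with
  | zero =>
    rw [Finset.sum_range_add]
    congr 1
    · rw [Finset.sum_congr rfl (g := fun _ => u)]
      · simp
      · intro j hj
        have hj := Finset.mem_range.1 hj
        rw [if_pos]
        rw [Nat.zero_add, Nat.mod_eq_of_lt (by omega)]
        exact hj
    · rw [Finset.sum_congr rfl (g := fun _ => v)]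
      · simp
      · intro j hj
        have hj := Finset.mem_range.1 hj
        rw [if_neg]
        rw [Nat.zero_add, Nat.mod_eq_of_lt (by omega)]
        omega
  | succ c ih =>
    have h1 := Finset.sum_range_succ (fun j => if (c + j) % (m + n) < m then u else v) (m + n)
    have h2 := Finset.sum_range_succ' (fun j => if (c + j) % (m + n) < m then u else v) (m + n)
    rw [h1] at h2
    simp only [Nat.add_mod_right, Nat.add_zero, add_left_inj] at h2
    rw [← ih, h2]
    refine Finset.sum_congr rfl fun j _ => ?_
    rw [show c + 1 + j = c + (j + 1) by ring]

lemma tip_growth {Ω : Type*} {m0 : MeasurableSpace Ω} (P : Measure Ω) [IsProbabilityMeasure P]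
    (a U V : ℕ → Ω → ℝ) (ha : ∀ k, Measurable (a k)) (u v C : ℝ)
    (hU : (∀ k, 1 ≤ k → Integrable (fun ω => |U k ω - u|) P) ∧
      Tendsto (fun k => ∫ ω, |U k ω - u| ∂P) atTop (nhds 0))
    (hV : (∀ k, 1 ≤ k → Integrable (fun ω => |V k ω - v|) P) ∧
      Tendsto (fun k => ∫ ω, |V k ω - v| ∂P) atTop (nhds 0))
    (g : ℕ → ℝ) (hC : 0 ≤ C)
    (hbd : ∀ k ω, |a (k + 1) ω - a k ω - g k| ≤ C * (|U (k + 1) ω - u| + |V k ω - v|))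
    (N c : ℕ) (hN : 1 ≤ N) (hc : 1 ≤ c) (A : ℝ)
    (hg : ∀ q, ∑ j ∈ Finset.range N, g (N * q + c + j) = A) :
    TendstoInMeasure P (fun (q : ℕ) ω => a (N * q + c) ω / q) atTop (fun _ => A) := by
  set e : ℕ → Ω → ℝ := fun k ω => C * (|U (k + 1) ω - u| + |V k ω - v|) with he
  have hei : ∀ k, 1 ≤ k → Integrable (e k) P := fun k hk =>
    ((hU.1 (k + 1) (by omega)).add (hV.1 k hk)).const_mul C
  have hel : Tendsto (fun k => ∫ ω, e k ω ∂P) atTop (nhds 0) := by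
    have h1 : Tendsto (fun k => C * (∫ ω, |U (k + 1) ω - u| ∂P + ∫ ω, |V k ω - v| ∂P)) atTop
        (nhds (C * (0 + 0))) :=
      ((hU.2.comp (tendsto_add_atTop_nat 1)).add hV.2).const_mul C
    rw [add_zero, mul_zero] at h1
    refine h1.congr' ?_
    filter_upwards [eventually_ge_atTop 1] with k hk
    rw [he, integral_const_mul, integral_add (hU.1 (k + 1) (by omega)) (hV.1 k hk)]
  have hen : ∀ k ω, 0 ≤ e k ω := fun k ω => by simp only [he]; positivity
  set Y : ℕ → Ω → ℝ := fun i ω => ∑ j ∈ Finset.range N, e (N * i + c + j) ω with hY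
  have hYi : ∀ i, Integrable (Y i) P := fun i =>
    integrable_finsetSum _ fun j _ => hei _ (by omega)
  have hYl : Tendsto (fun i => ∫ ω, Y i ω ∂P) atTop (nhds 0) := by
    have h1 : ∀ i, ∫ ω, Y i ω ∂P = ∑ j ∈ Finset.range N, ∫ ω, e (N * i + c + j) ω ∂P := fun i =>
      integral_finsetSum _ fun j _ => hei _ (by omega)
    simp_rw [h1]
    rw [show (0 : ℝ) = ∑ j ∈ Finset.range N, (0 : ℝ) by simp]
    refine tendsto_finsetSum _ fun j _ => ?_
    refine hel.comp ?_
    refine tendsto_atTop_mono (f := fun i => i) (fun i => ?_) tendsto_id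
    nlinarith
  have hYn : ∀ i ω, 0 ≤ Y i ω := fun i ω => Finset.sum_nonneg fun j _ => hen _ _
  set Z : ℕ → Ω → ℝ := fun q ω => (q : ℝ)⁻¹ * ∑ i ∈ Finset.range q, Y i ω with hZ
  have hZi : ∀ q, Integrable (Z q) P := fun q =>
    (integrable_finsetSum _ fun i _ => hYi i).const_mul _
  have hZl : Tendsto (fun q => ∫ ω, Z q ω ∂P) atTop (nhds 0) := by
    refine hYl.cesaro.congr fun q => ?_
    rw [hZ, integral_const_mul, integral_finsetSum _ fun i _ => hYi i]
  have hZn : ∀ q ω, 0 ≤ Z q ω := fun q ω =>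
    mul_nonneg (by positivity) (Finset.sum_nonneg fun i _ => hYn i ω)
  have hstep : ∀ q ω, |a (N * (q + 1) + c) ω - a (N * q + c) ω - A| ≤ Y q ω := by
    intro q ω
    have h1 := Finset.sum_range_sub (fun j => a (N * q + c + j) ω) N
    have h2 : a (N * (q + 1) + c) ω - a (N * q + c) ω - A =
        ∑ j ∈ Finset.range N, (a (N * q + c + j + 1) ω - a (N * q + c + j) ω
          - g (N * q + c + j)) := by
      rw [Finset.sum_sub_distrib, hg q]
      simp only [← add_assoc, add_zero] at h1
      rw [h1, show N * (q + 1) + c = N * q + c + N by ring]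
    rw [h2]
    exact (Finset.abs_sum_le_sum_abs _ _).trans (Finset.sum_le_sum fun j _ => hbd _ ω)
  have htot : ∀ q ω, |a (N * q + c) ω - a c ω - q * A| ≤ ∑ i ∈ Finset.range q, Y i ω := by
    intro q ω
    induction q with
    | zero => simp
    | succ q ih =>
      rw [Finset.sum_range_succ]
      have := abs_add_le (a (N * q + c) ω - a c ω - q * A)
        (a (N * (q + 1) + c) ω - a (N * q + c) ω - A)
      have h3 := hstep q ω
      rw [show a (N * (q + 1) + c) ω - a c ω - ((q + 1 : ℕ) : ℝ) * A =
        (a (N * q + c) ω - a c ω - q * A) + (a (N * (q + 1) + c) ω - a (N * q + c) ω - A) by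
          push_cast; ring]
      linarith
  have h0 : TendstoInMeasure P (fun (q : ℕ) ω => a c ω / q) atTop (fun _ => (0 : ℝ)) := by
    refine tendstoInMeasure_of_tendsto_ae
      (fun q => ((ha c).div_const _).aestronglyMeasurable) ?_
    exact Eventually.of_forall fun ω => tendsto_const_div_atTop_nhds_zero_nat (a c ω)
  rw [tendstoInMeasure_iff_measureReal_norm] at h0 ⊢
  intro ε hε
  have hl := (h0 (ε / 2) (by linarith)).add (hZl.const_mul (2 / ε))
  rw [mul_zero, add_zero] at hl
  refine squeeze_zero' (Eventually.of_forall fun q => measureReal_nonneg) ?_ hl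
  filter_upwards [eventually_ge_atTop 1] with q hq
  have hq0 : (0 : ℝ) < q := by exact_mod_cast hq
  have hsub : {ω | ε ≤ ‖a (N * q + c) ω / q - A‖} ⊆
      {ω | ε / 2 ≤ ‖a c ω / q - 0‖} ∪ {ω | ε / 2 ≤ Z q ω} := by
    intro ω hω
    by_contra hcon
    simp only [Set.mem_union, Set.mem_ofPred_eq, not_or, not_le] at hcon hω
    have h1 : a (N * q + c) ω / q - A = (a c ω / q - 0) +
        (q : ℝ)⁻¹ * (a (N * q + c) ω - a c ω - q * A) := by
      field_simp
      ring
    have h2 := norm_add_le (a c ω / q - 0) ((q : ℝ)⁻¹ * (a (N * q + c) ω - a c ω - q * A))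
    rw [← h1, norm_mul, Real.norm_of_nonneg (inv_nonneg.2 hq0.le)] at h2
    have h3 : (q : ℝ)⁻¹ * ‖a (N * q + c) ω - a c ω - q * A‖ ≤ Z q ω :=
      mul_le_mul_of_nonneg_left (htot q ω) (inv_nonneg.2 hq0.le)
    linarith [hcon.1, hcon.2]
  have hmk := mul_meas_ge_le_integral_of_nonneg (Eventually.of_forall (hZn q)) (hZi q) (ε / 2)
  have hmk2 : P.real {ω | ε / 2 ≤ Z q ω} ≤ 2 / ε * ∫ ω, Z q ω ∂P := by
    rw [div_mul_eq_mul_div, le_div_iff₀ hε]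
    linarith
  exact ((measureReal_mono hsub).trans (measureReal_union_le _ _)).trans (by gcongr)

lemma tip_algebra (Sx Fx Sy Fy Sxh Fxh Syh Fyh tx ty : ℝ) (h1 : 0 < Sx) (h2 : 0 < Fx)
    (h3 : 0 < Sy) (h4 : 0 < Fy) (h5 : 0 ≤ Sxh) (h6 : 0 ≤ Fxh) (h7 : 0 ≤ Syh) (h8 : 0 ≤ Fyh)
    (hx : tx = (Sx + Sxh * max (ty - tx) 0) /
      ((Sx + Sxh * max (ty - tx) 0) + (Fx + Fxh * max (tx - ty) 0)))
    (hy : ty = (Sy + Syh * max (tx - ty) 0) /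
      ((Sy + Syh * max (tx - ty) 0) + (Fy + Fyh * max (ty - tx) 0)))
    (hcase : Sx * Fy < Fx * Sy) :
    Fx * (tx / (1 - tx)) = Sxh * (ty - tx) + Sx ∧
      Sy * ((1 - ty) / ty) = Fyh * (ty - tx) + Fy := by
  have m1 : 0 ≤ max (ty - tx) 0 := le_max_right _ _
  have m2 : 0 ≤ max (tx - ty) 0 := le_max_right _ _
  have pA : 0 < Sx + Sxh * max (ty - tx) 0 := by positivity
  have pB : 0 < Fx + Fxh * max (tx - ty) 0 := by positivity
  have pC : 0 < Sy + Syh * max (tx - ty) 0 := by positivity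
  have pD : 0 < Fy + Fyh * max (ty - tx) 0 := by positivity
  have x0 : 0 < tx := by rw [hx]; positivity
  have y0 : 0 < ty := by rw [hy]; positivity
  have x1 : tx < 1 := by rw [hx, div_lt_one (by positivity)]; linarith
  have y1 : ty < 1 := by rw [hy, div_lt_one (by positivity)]; linarith
  rw [eq_div_iff (by positivity)] at hx hy
  have hle : tx ≤ ty := by
    by_contra hlt
    push Not at hlt
    have e1 : max (ty - tx) 0 = 0 := max_eq_right (by linarith)
    rw [e1] at hx hy
    have hx1 : Fx * tx ≤ Sx * (1 - tx) := by nlinarith [mul_nonneg (mul_nonneg h6 m2) x0.le]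
    have hy1 : Sy * (1 - ty) ≤ Fy * ty := by
      nlinarith [mul_nonneg (mul_nonneg h7 m2) (sub_nonneg.2 y1.le)]
    have a1 : (Fx * tx) * (Sy * (1 - ty)) ≤ (Sx * (1 - tx)) * (Fy * ty) :=
      mul_le_mul hx1 hy1 (by have := sub_pos.2 y1; positivity)
        (by have := sub_pos.2 x1; positivity)
    have a2 : (1 - tx) * ty < tx * (1 - ty) := by nlinarith
    have a3 : (Sx * Fy) * ((1 - tx) * ty) < (Fx * Sy) * (tx * (1 - ty)) :=
      mul_lt_mul'' hcase a2 (by positivity) (by have := sub_pos.2 x1; positivity)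
    linarith
  have e1 : max (ty - tx) 0 = ty - tx := max_eq_left (by linarith)
  have e2 : max (tx - ty) 0 = 0 := max_eq_right (by linarith)
  rw [e1, e2] at hx hy
  have := sub_pos.2 x1
  constructor
  · rw [← mul_div_assoc, div_eq_iff (by positivity)]
    linarith
  · rw [← mul_div_assoc, div_eq_iff (by positivity)]
    linarith

lemma tip_max_bd (C p q u v : ℝ) (hC : 0 ≤ C) :
    |C * max (p - q) 0 - C * max (u - v) 0| ≤ C * (|p - u| + |q - v|) := by
  rw [← mul_sub, abs_mul, abs_of_nonneg hC]
  refine mul_le_mul_of_nonneg_left ?_ hC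
  refine (abs_max_sub_max_le_abs _ _ _).trans ?_
  rw [show p - q - (u - v) = (p - u) - (q - v) by ring]
  exact abs_sub _ _

/-- **Equilibrium equations for the limiting trust values in the TIP model (case
`Sˣ·Fʸ < Fˣ·Sʸ`).** If `tx` and `ty` are the in-probability limits of the trust
processes `Tx` and `Ty`, then they satisfy the system
`Fˣ·tx/(1−tx) = Ŝˣ·(ty−tx) + Sˣ` and `Sʸ·(1−ty)/ty = F̂ʸ·(ty−tx) + Fʸ`. -/
theorem tip_equilibrium_case2
    {Ω : Type*} [MeasurableSpace Ω] (P : Measure Ω) [IsProbabilityMeasure P]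
    (ℱ : Filtration ℕ ‹MeasurableSpace Ω›)
    -- parameters
    (r : ℝ) (hr : r ∈ Set.Ioo (0 : ℝ) 1)
    (m n : ℕ) (hm : 1 ≤ m)
    (sx fx sy fy : ℝ) (hsx : 0 < sx) (hfx : 0 < fx) (hsy : 0 < sy) (hfy : 0 < fy)
    (sxh fxh syh fyh : ℝ) (hsxh : 0 < sxh) (hfxh : 0 < fxh) (hsyh : 0 < syh) (hfyh : 0 < fyh)
    (txy tyx : ℝ) (htxy : txy ∈ Set.Ioc (0 : ℝ) 1) (htyx : tyx ∈ Set.Ioc (0 : ℝ) 1)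
    (ax0 bx0 ay0 by0 : ℝ) (hax0 : 0 < ax0) (hbx0 : 0 < bx0) (hay0 : 0 < ay0) (hby0 : 0 < by0)
    -- processes
    (ax bx ay bY : ℕ → Ω → ℝ) (Tx Ty : ℕ → Ω → ℝ)
    (hax_init : ∀ ω, ax 0 ω = ax0) (hbx_init : ∀ ω, bx 0 ω = bx0)
    (hay_init : ∀ ω, ay 0 ω = ay0) (hbY_init : ∀ ω, bY 0 ω = by0)
    -- all processes are adapted to the filtration
    (hax_adapted : Adapted ℱ ax) (hbx_adapted : Adapted ℱ bx)
    (hay_adapted : Adapted ℱ ay) (hbY_adapted : Adapted ℱ bY)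
    (hTx_adapted : Adapted ℱ Tx) (hTy_adapted : Adapted ℱ Ty)
    -- update equations at x-steps: x updates directly, y indirectly
    (hxstep : ∀ k, 1 ≤ k → (k - 1) % (m + n) < m → ∀ ω,
      ax k ω = ax (k - 1) ω + sx * r ∧
      bx k ω = bx (k - 1) ω + fx * (1 - r) ∧
      ay k ω = ay (k - 1) ω + syh * tyx * max (Tx k ω - Ty (k - 1) ω) 0 ∧
      bY k ω = bY (k - 1) ω + fyh * tyx * max (Ty (k - 1) ω - Tx k ω) 0)
    -- update equations at y-steps: y updates directly, x indirectly
    (hystep : ∀ k, 1 ≤ k → ¬ (k - 1) % (m + n) < m → ∀ ω,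
      ay k ω = ay (k - 1) ω + sy * r ∧
      bY k ω = bY (k - 1) ω + fy * (1 - r) ∧
      ax k ω = ax (k - 1) ω + sxh * txy * max (Ty k ω - Tx (k - 1) ω) 0 ∧
      bx k ω = bx (k - 1) ω + fxh * txy * max (Tx (k - 1) ω - Ty k ω) 0)
    -- at an x-step, the conditional distribution of `Tx k` given the past is
    -- Beta(ax k, bx k), and that of `Ty k` given the past and `Tx k` is Beta(ay k, bY k)
    (hTx_condLaw_xstep : ∀ k, 1 ≤ k → (k - 1) % (m + n) < m → ∀ A : Set ℝ, MeasurableSet A →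
      P[fun ω => A.indicator (fun _ => (1 : ℝ)) (Tx k ω) | ℱ (k - 1)]
        =ᵐ[P] fun ω => (betaMeasure (ax k ω) (bx k ω) A).toReal)
    (hTy_condLaw_xstep : ∀ k, 1 ≤ k → (k - 1) % (m + n) < m → ∀ A : Set ℝ, MeasurableSet A →
      P[fun ω => A.indicator (fun _ => (1 : ℝ)) (Ty k ω)
          | (ℱ (k - 1) : MeasurableSpace Ω) ⊔ MeasurableSpace.comap (Tx k) inferInstance]
        =ᵐ[P] fun ω => (betaMeasure (ay k ω) (bY k ω) A).toReal)
    -- at a y-step, symmetrically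
    (hTy_condLaw_ystep : ∀ k, 1 ≤ k → ¬ (k - 1) % (m + n) < m → ∀ A : Set ℝ, MeasurableSet A →
      P[fun ω => A.indicator (fun _ => (1 : ℝ)) (Ty k ω) | ℱ (k - 1)]
        =ᵐ[P] fun ω => (betaMeasure (ay k ω) (bY k ω) A).toReal)
    (hTx_condLaw_ystep : ∀ k, 1 ≤ k → ¬ (k - 1) % (m + n) < m → ∀ A : Set ℝ, MeasurableSet A →
      P[fun ω => A.indicator (fun _ => (1 : ℝ)) (Tx k ω)
          | (ℱ (k - 1) : MeasurableSpace Ω) ⊔ MeasurableSpace.comap (Ty k) inferInstance]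
        =ᵐ[P] fun ω => (betaMeasure (ax k ω) (bx k ω) A).toReal)
    -- `tx` and `ty` are the in-probability limits of the trust processes
    (tx ty : ℝ)
    (htx_lim : ∀ ε > 0, Tendsto (fun k => P {ω | ε < |Tx k ω - tx|}) atTop (nhds 0))
    (hty_lim : ∀ ε > 0, Tendsto (fun k => P {ω | ε < |Ty k ω - ty|}) atTop (nhds 0))
    -- case condition: `Sˣ·Fʸ < Fˣ·Sʸ`
    (hcase : (m : ℝ) * sx * r * ((n : ℝ) * fy * (1 - r)) <
      (m : ℝ) * fx * (1 - r) * ((n : ℝ) * sy * r)) :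
    (m : ℝ) * fx * (1 - r) * (tx / (1 - tx)) =
        (n : ℝ) * txy * sxh * (ty - tx) + (m : ℝ) * sx * r ∧
      (n : ℝ) * sy * r * ((1 - ty) / ty) =
        (m : ℝ) * tyx * fyh * (ty - tx) + (n : ℝ) * fy * (1 - r) := by
  obtain ⟨hr0, hr1⟩ := hr
  have hr1' : 0 < 1 - r := by linarith
  have hn : 1 ≤ n := by
    rcases Nat.eq_zero_or_pos n with h | h
    · subst h; simp at hcase
    · exact h
  have hm0 : (0 : ℝ) < m := by exact_mod_cast hm
  have hn0 : (0 : ℝ) < n := by exact_mod_cast hn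
  have hxy0 := htxy.1
  have hyx0 := htyx.1
  have max_ax : ∀ k, Measurable (ax k) := fun k => (hax_adapted k).mono (ℱ.le k) le_rfl
  have max_bx : ∀ k, Measurable (bx k) := fun k => (hbx_adapted k).mono (ℱ.le k) le_rfl
  have max_ay : ∀ k, Measurable (ay k) := fun k => (hay_adapted k).mono (ℱ.le k) le_rfl
  have max_bY : ∀ k, Measurable (bY k) := fun k => (hbY_adapted k).mono (ℱ.le k) le_rfl
  have mTx : ∀ k, Measurable (Tx k) := fun k => (hTx_adapted k).mono (ℱ.le k) le_rfl
  have mTy : ∀ k, Measurable (Ty k) := fun k => (hTy_adapted k).mono (ℱ.le k) le_rfl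
  have hxs : ∀ k, k % (m + n) < m → ∀ ω,
      ax (k + 1) ω = ax k ω + sx * r ∧
      bx (k + 1) ω = bx k ω + fx * (1 - r) ∧
      ay (k + 1) ω = ay k ω + syh * tyx * max (Tx (k + 1) ω - Ty k ω) 0 ∧
      bY (k + 1) ω = bY k ω + fyh * tyx * max (Ty k ω - Tx (k + 1) ω) 0 := fun k hk ω => by
    simpa using hxstep (k + 1) (by omega) (by simpa using hk) ω
  have hys : ∀ k, ¬ k % (m + n) < m → ∀ ω,
      ay (k + 1) ω = ay k ω + sy * r ∧
      bY (k + 1) ω = bY k ω + fy * (1 - r) ∧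
      ax (k + 1) ω = ax k ω + sxh * txy * max (Ty (k + 1) ω - Tx k ω) 0 ∧
      bx (k + 1) ω = bx k ω + fxh * txy * max (Tx k ω - Ty (k + 1) ω) 0 := fun k hk ω => by
    simpa using hystep (k + 1) (by omega) (by simpa using hk) ω
  have hpos : ∀ k ω, 0 < ax k ω ∧ 0 < bx k ω ∧ 0 < ay k ω ∧ 0 < bY k ω := by
    intro k ω
    induction k with
    | zero => rw [hax_init, hbx_init, hay_init, hbY_init]; exact ⟨hax0, hbx0, hay0, hby0⟩
    | succ k ih =>
      obtain ⟨i1, i2, i3, i4⟩ := ih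
      by_cases hk : k % (m + n) < m
      · obtain ⟨e1, e2, e3, e4⟩ := hxs k hk ω
        have := le_max_right (Tx (k + 1) ω - Ty k ω) 0
        have := le_max_right (Ty k ω - Tx (k + 1) ω) 0
        rw [e1, e2, e3, e4]
        refine ⟨?_, ?_, ?_, ?_⟩ <;> positivity
      · obtain ⟨e1, e2, e3, e4⟩ := hys k hk ω
        have := le_max_right (Ty (k + 1) ω - Tx k ω) 0
        have := le_max_right (Tx k ω - Ty (k + 1) ω) 0
        rw [e1, e2, e3, e4]
        refine ⟨?_, ?_, ?_, ?_⟩ <;> positivity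
  have bTx : ∀ k, 1 ≤ k → ∀ᵐ ω ∂P, Tx k ω ∈ Set.Icc (0 : ℝ) 1 := by
    intro k hk
    by_cases h : (k - 1) % (m + n) < m
    · exact tip_law_Icc P (ax k) (bx k) (Tx k) (mTx k) _ (ℱ.le (k - 1)) (hTx_condLaw_xstep k hk h)
    · exact tip_law_Icc P (ax k) (bx k) (Tx k) (mTx k) _
        (sup_le (ℱ.le (k - 1)) (mTy k).comap_le) (hTx_condLaw_ystep k hk h)
  have bTy : ∀ k, 1 ≤ k → ∀ᵐ ω ∂P, Ty k ω ∈ Set.Icc (0 : ℝ) 1 := by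
    intro k hk
    by_cases h : (k - 1) % (m + n) < m
    · exact tip_law_Icc P (ay k) (bY k) (Ty k) (mTy k) _
        (sup_le (ℱ.le (k - 1)) (mTx k).comap_le) (hTy_condLaw_xstep k hk h)
    · exact tip_law_Icc P (ay k) (bY k) (Ty k) (mTy k) _ (ℱ.le (k - 1)) (hTy_condLaw_ystep k hk h)
  have LX := tip_L1 P Tx mTx bTx tx htx_lim
  have LY := tip_L1 P Ty mTy bTy ty hty_lim
  have gax := tip_growth P ax Ty Tx max_ax ty tx (sxh * txy) LY LX
    (fun k => if k % (m + n) < m then sx * r else sxh * txy * max (ty - tx) 0) (by positivity)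
    (by
      intro k ω
      by_cases hk : k % (m + n) < m
      · rw [(hxs k hk ω).1]
        simp only [hk, if_true, add_sub_cancel_left, sub_self, abs_zero]
        positivity
      · rw [(hys k hk ω).2.2.1]
        simp only [hk, if_false, add_sub_cancel_left]
        exact tip_max_bd _ _ _ _ _ (by positivity))
    (m + n) 1 (by omega) le_rfl _ (fun q => tip_sum_periodic m n _ _ _)
  have gbx := tip_growth P bx Ty Tx max_bx ty tx (fxh * txy) LY LX
    (fun k => if k % (m + n) < m then fx * (1 - r) else fxh * txy * max (tx - ty) 0)
    (by positivity)
    (by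
      intro k ω
      by_cases hk : k % (m + n) < m
      · rw [(hxs k hk ω).2.1]
        simp only [hk, if_true, add_sub_cancel_left, sub_self, abs_zero]
        positivity
      · rw [(hys k hk ω).2.2.2]
        simp only [hk, if_false, add_sub_cancel_left]
        rw [add_comm (|_|)]
        exact tip_max_bd _ _ _ _ _ (by positivity))
    (m + n) 1 (by omega) le_rfl _ (fun q => tip_sum_periodic m n _ _ _)
  have gay := tip_growth P ay Tx Ty max_ay tx ty (syh * tyx) LX LY
    (fun k => if k % (m + n) < m then syh * tyx * max (tx - ty) 0 else sy * r) (by positivity)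
    (by
      intro k ω
      by_cases hk : k % (m + n) < m
      · rw [(hxs k hk ω).2.2.1]
        simp only [hk, if_true, add_sub_cancel_left]
        exact tip_max_bd _ _ _ _ _ (by positivity)
      · rw [(hys k hk ω).1]
        simp only [hk, if_false, add_sub_cancel_left, sub_self, abs_zero]
        positivity)
    (m + n) (m + 1) (by omega) (by omega) _ (fun q => tip_sum_periodic m n _ _ _)
  have gbY := tip_growth P bY Tx Ty max_bY tx ty (fyh * tyx) LX LY
    (fun k => if k % (m + n) < m then fyh * tyx * max (ty - tx) 0 else fy * (1 - r))
    (by positivity)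
    (by
      intro k ω
      by_cases hk : k % (m + n) < m
      · rw [(hxs k hk ω).2.2.2]
        simp only [hk, if_true, add_sub_cancel_left]
        rw [add_comm (|_|)]
        exact tip_max_bd _ _ _ _ _ (by positivity)
      · rw [(hys k hk ω).2.1]
        simp only [hk, if_false, add_sub_cancel_left, sub_self, abs_zero]
        positivity)
    (m + n) (m + 1) (by omega) (by omega) _ (fun q => tip_sum_periodic m n _ _ _)
  have M1 : 0 ≤ max (ty - tx) 0 := le_max_right _ _
  have M2 : 0 ≤ max (tx - ty) 0 := le_max_right _ _
  have hKlim : ∀ c, Tendsto (fun q => (m + n) * q + c) atTop atTop := fun c => by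
    refine tendsto_atTop_mono (f := fun i => i) (fun i => ?_) tendsto_id
    nlinarith
  have hX := tip_concentration P (fun q => ℱ ((m + n) * q + 1 - 1)) (fun q => ℱ.le _)
    (fun q => ax ((m + n) * q + 1)) (fun q => bx ((m + n) * q + 1))
    (fun q => Tx ((m + n) * q + 1)) (fun q => mTx _) (fun q ω => (hpos _ ω).1)
    (fun q ω => (hpos _ ω).2.1)
    (fun q => hTx_condLaw_xstep ((m + n) * q + 1) (by omega) (by simp; omega))
    _ _ (by positivity) (by positivity) gax gbx tx (fun ε hε => (htx_lim ε hε).comp (hKlim 1))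
  have hYY := tip_concentration P (fun q => ℱ ((m + n) * q + (m + 1) - 1)) (fun q => ℱ.le _)
    (fun q => ay ((m + n) * q + (m + 1))) (fun q => bY ((m + n) * q + (m + 1)))
    (fun q => Ty ((m + n) * q + (m + 1))) (fun q => mTy _) (fun q ω => (hpos _ ω).2.2.1)
    (fun q ω => (hpos _ ω).2.2.2)
    (fun q => hTy_condLaw_ystep ((m + n) * q + (m + 1)) (by omega) (by
      rw [show (m + n) * q + (m + 1) - 1 = m + (m + n) * q by omega, Nat.add_mul_mod_self_left,
        Nat.mod_eq_of_lt (by omega)]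
      omega))
    _ _ (by positivity) (by positivity) gay gbY ty
    (fun ε hε => (hty_lim ε hε).comp (hKlim (m + 1)))
  refine tip_algebra (m * sx * r) (m * fx * (1 - r)) (n * sy * r) (n * fy * (1 - r))
    (n * txy * sxh) (n * txy * fxh) (m * tyx * syh) (m * tyx * fyh) tx ty
    (by positivity) (by positivity) (by positivity) (by positivity) (by positivity)
    (by positivity) (by positivity) (by positivity) ?_ ?_ hcase
  · refine hX.trans ?_
    ring_nf
  · refine hYY.trans ?_
    ring_nf
end

section
/- Consider the deterministic mean dynamics of the TIP alternating-interaction model: with parameters r ∈ (0,1), r̄ = 1−r, integers m ≥ 1, n ≥ 0, positive gains s^x, f^x, s^y, f^y, ŝ^x, f̂^x, ŝ^y, f̂^y, interpersonal trusts t^{xy}, t^{yx} ∈ (0,1], and initial values a^x_0, b^x_0, a^y_0, b^y_0 > 0, define for k ≥ 1 (writing μ^x_k = a^x_k/(a^x_k+b^x_k) and μ^y_k = a^y_k/(a^y_k+b^y_k)): if (k−1) mod (m+n) < m, then a^x_k = a^x_{k−1} + s^x·r, b^x_k = b^x_{k−1} + f^x·r̄, a^y_k = a^y_{k−1} + ŝ^y·t^{yx}·max(μ^x_k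 − μ^y_{k−1}, 0), b^y_k = b^y_{k−1} + f̂^y·t^{yx}·max(μ^y_{k−1} − μ^x_k, 0); otherwise the symmetric updates hold with the roles of x and y interchanged. Then the sequences (μ^x_k) and (μ^y_k) converge: there exist t^x, t^y ∈ [0,1] with μ^x_k → t^x and μ^y_k → t^y. -/
open Filter

noncomputable def tipG (p q u v x y : ℝ) : ℝ :=
  (1 - x) * (p + u * max (y - x) 0) - x * (q + v * max (x - y) 0)

lemma tip_max_diff (d e : ℝ) : ∃ l : ℝ, 0 ≤ l ∧ l ≤ 1 ∧ max d 0 - max e 0 = l * (d - e) := by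
  rcases eq_or_ne d e with h | h
  · exact ⟨0, le_rfl, zero_le_one, by rw [h]; ring⟩
  · have hne : d - e ≠ 0 := sub_ne_zero.mpr h
    refine ⟨(max d 0 - max e 0) / (d - e), ?_, ?_, by field_simp⟩
    · rcases lt_or_gt_of_ne h with h | h
      · apply div_nonneg_of_nonpos
        · have := max_le_max_right 0 h.le
          linarith
        · linarith
      · apply div_nonneg
        · have := max_le_max_right 0 h.le
          linarith
        · linarith
    · rcases lt_or_gt_of_ne h with h | h
      · rw [div_le_one_of_neg (by linarith)]
        rcases le_total d 0 with h1 | h1 <;> rcases le_total e 0 with h2 | h2 <;>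
          simp only [max_eq_left, max_eq_right, h1, h2] <;> linarith
      · rw [div_le_one (by linarith)]
        rcases le_total d 0 with h1 | h1 <;> rcases le_total e 0 with h2 | h2 <;>
          simp only [max_eq_left, max_eq_right, h1, h2] <;> linarith

lemma tipG_diff (p q u v x y x' y' : ℝ) (hu : 0 ≤ u) (hv : 0 ≤ v)
    (hx : x ∈ Set.Icc (0:ℝ) 1) (hx' : x' ∈ Set.Icc (0:ℝ) 1)
    (hy' : y' ∈ Set.Icc (0:ℝ) 1) :
    ∃ A B : ℝ, 0 ≤ A ∧ 0 ≤ B ∧ A + B ≤ 2 * (u + v) ∧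
      tipG p q u v x y - tipG p q u v x' y' = -(p + q + A + B) * (x - x') + A * (y - y') := by
  obtain ⟨l, l0, l1, hl⟩ := tip_max_diff (y - x) (y' - x')
  obtain ⟨k, k0, k1, hk⟩ := tip_max_diff (x - y) (x' - y')
  obtain ⟨hx0, hx1⟩ := hx
  obtain ⟨hx0', hx1'⟩ := hx'
  obtain ⟨hy0', hy1'⟩ := hy'
  have hE0 : 0 ≤ max (y' - x') 0 := le_max_right _ _
  have hF0 : 0 ≤ max (x' - y') 0 := le_max_right _ _
  have hE1 : max (y' - x') 0 ≤ 1 := max_le (by linarith) zero_le_one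
  have hF1 : max (x' - y') 0 ≤ 1 := max_le (by linarith) zero_le_one
  have t1 : (1 - x) * l ≤ 1 := mul_le_one₀ (by linarith) l0 l1
  have t2 : x * k ≤ 1 := mul_le_one₀ (by linarith) k0 k1
  have t3 : 0 ≤ (1 - x) * l := mul_nonneg (by linarith) l0
  have t4 : 0 ≤ x * k := mul_nonneg (by linarith) k0
  refine ⟨u * ((1 - x) * l) + v * (x * k), u * max (y' - x') 0 + v * max (x' - y') 0,
    by positivity, by positivity, ?_, ?_⟩
  · nlinarith [mul_le_mul_of_nonneg_left t1 hu, mul_le_mul_of_nonneg_left t2 hv,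
      mul_le_mul_of_nonneg_left hE1 hu, mul_le_mul_of_nonneg_left hF1 hv]
  · unfold tipG
    have e1 : max (y - x) 0 = max (y' - x') 0 + l * (y - x - (y' - x')) := by linarith
    have e2 : max (x - y) 0 = max (x' - y') 0 + k * (x - y - (x' - y')) := by linarith
    rw [e1, e2]
    ring

lemma tipG_contract (p q u v x y x' y' V g : ℝ) (hp : 0 < p) (hq : 0 < q)
    (hu : 0 ≤ u) (hv : 0 ≤ v)
    (hx : x ∈ Set.Icc (0:ℝ) 1) (hx' : x' ∈ Set.Icc (0:ℝ) 1)
    (hy' : y' ∈ Set.Icc (0:ℝ) 1) (hV1 : |x - x'| ≤ V) (hV2 : |y - y'| ≤ V)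
    (hg : 0 ≤ g) (hgL : g * (p + q + 2 * (u + v)) ≤ 1) :
    |(x + g * tipG p q u v x y) - (x' + g * tipG p q u v x' y')| ≤ (1 - g * (p + q)) * V := by
  obtain ⟨A, B, hA, hB, hAB, h⟩ := tipG_diff p q u v x y x' y' hu hv hx hx' hy'
  have e : (x + g * tipG p q u v x y) - (x' + g * tipG p q u v x' y')
      = (1 - g * (p + q + A + B)) * (x - x') + (g * A) * (y - y') := by
    have : (x + g * tipG p q u v x y) - (x' + g * tipG p q u v x' y') =
      (x - x') + g * (tipG p q u v x y - tipG p q u v x' y') := by ring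
    rw [this, h]; ring
  have c0 : 0 ≤ 1 - g * (p + q + A + B) := by
    have : g * (p + q + A + B) ≤ g * (p + q + 2 * (u + v)) :=
      mul_le_mul_of_nonneg_left (by linarith) hg
    linarith
  have hV : 0 ≤ V := (abs_nonneg _).trans hV1
  rw [e]
  calc _ ≤ |(1 - g * (p + q + A + B)) * (x - x')| + |(g * A) * (y - y')| := abs_add_le _ _
    _ = (1 - g * (p + q + A + B)) * |x - x'| + (g * A) * |y - y'| := by
        rw [abs_mul, abs_mul, abs_of_nonneg c0, abs_of_nonneg (mul_nonneg hg hA)]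
    _ ≤ (1 - g * (p + q + A + B)) * V + (g * A) * V := by gcongr
    _ = (1 - g * (p + q)) * V - g * B * V := by ring
    _ ≤ _ := by
        have : 0 ≤ g * B * V := by positivity
        linarith

lemma tipG_maps (p q u v x y g : ℝ) (hp : 0 < p) (hq : 0 < q)
    (hu : 0 ≤ u) (hv : 0 ≤ v)
    (hx : x ∈ Set.Icc (0:ℝ) 1) (hy : y ∈ Set.Icc (0:ℝ) 1)
    (hg : 0 ≤ g) (hgL : g * (p + q + 2 * (u + v)) ≤ 1) :
    x + g * tipG p q u v x y ∈ Set.Icc (0:ℝ) 1 := by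
  obtain ⟨hx0, hx1⟩ := hx
  obtain ⟨hy0, hy1⟩ := hy
  have hE0 : 0 ≤ max (y - x) 0 := le_max_right _ _
  have hF0 : 0 ≤ max (x - y) 0 := le_max_right _ _
  have hE1 : max (y - x) 0 ≤ 1 := max_le (by linarith) zero_le_one
  have hF1 : max (x - y) 0 ≤ 1 := max_le (by linarith) zero_le_one
  have a1 : g * (p + u * max (y - x) 0) ≤ 1 := by
    refine le_trans (mul_le_mul_of_nonneg_left ?_ hg) hgL
    nlinarith
  have a2 : g * (q + v * max (x - y) 0) ≤ 1 := by
    refine le_trans (mul_le_mul_of_nonneg_left ?_ hg) hgL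
    nlinarith
  have b1 : 0 ≤ g * (p + u * max (y - x) 0) := by positivity
  have b2 : 0 ≤ g * (q + v * max (x - y) 0) := by positivity
  unfold tipG
  constructor <;> nlinarith

lemma tip_fixed (p q u v p' q' u' v' : ℝ) (hp : 0 < p) (hq : 0 < q)
    (hu : 0 ≤ u) (hv : 0 ≤ v) (hp' : 0 < p') (hq' : 0 < q')
    (hu' : 0 ≤ u') (hv' : 0 ≤ v') :
    ∃ x y : ℝ, x ∈ Set.Icc (0:ℝ) 1 ∧ y ∈ Set.Icc (0:ℝ) 1 ∧
      tipG p q u v x y = 0 ∧ tipG p' q' u' v' y x = 0 := by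
  set g := 1 / (p + q + 2 * (u + v)) with hgdef
  set g' := 1 / (p' + q' + 2 * (u' + v')) with hgdef'
  have hg : 0 < g := by positivity
  have hg' : 0 < g' := by positivity
  have hgL : g * (p + q + 2 * (u + v)) ≤ 1 := by rw [hgdef, one_div_mul_cancel (by positivity)]
  have hgL' : g' * (p' + q' + 2 * (u' + v')) ≤ 1 := by
    rw [hgdef', one_div_mul_cancel (by positivity)]
  let s : Set (ℝ × ℝ) := Set.Icc (0:ℝ) 1 ×ˢ Set.Icc (0:ℝ) 1
  let T : ℝ × ℝ → ℝ × ℝ := fun z =>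
    (z.1 + g * tipG p q u v z.1 z.2, z.2 + g' * tipG p' q' u' v' z.2 z.1)
  have hT : Set.MapsTo T s s := by
    rintro ⟨x, y⟩ ⟨hx, hy⟩
    exact ⟨tipG_maps p q u v x y g hp hq hu hv hx hy hg.le hgL,
      tipG_maps p' q' u' v' y x g' hp' hq' hu' hv' hy hx hg'.le hgL'⟩
  have hk1 : 0 ≤ 1 - g * (p + q) := by
    have : g * (p + q) ≤ g * (p + q + 2 * (u + v)) :=
      mul_le_mul_of_nonneg_left (by linarith) hg.le
    linarith
  let K : NNReal := ⟨max (1 - g * (p + q)) (1 - g' * (p' + q')), hk1.trans (le_max_left _ _)⟩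
  have hK : ContractingWith K (hT.restrict T s s) := by
    constructor
    · rw [← NNReal.coe_lt_coe]
      change max _ _ < (1:ℝ)
      have h1 : 0 < g * (p + q) := by positivity
      have h2 : 0 < g' * (p' + q') := by positivity
      exact max_lt (by linarith) (by linarith)
    · apply LipschitzWith.of_dist_le_mul
      rintro ⟨⟨x, y⟩, hx, hy⟩ ⟨⟨x', y'⟩, hx', hy'⟩
      rw [Subtype.dist_eq, Subtype.dist_eq, Prod.dist_eq, Prod.dist_eq]
      change max (|_ - _|) (|_ - _|) ≤ max _ _ * max (|x - x'|) (|y - y'|)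
      have hm0 : 0 ≤ max (|x - x'|) (|y - y'|) := (abs_nonneg _).trans (le_max_left _ _)
      apply max_le
      · refine (tipG_contract p q u v x y x' y' _ g hp hq hu hv hx hx' hy'
          (le_max_left _ _) (le_max_right _ _) hg.le hgL).trans ?_
        exact mul_le_mul_of_nonneg_right (le_max_left _ _) hm0
      · refine (tipG_contract p' q' u' v' y x y' x' _ g' hp' hq' hu' hv' hy hy' hx'
          (le_max_right _ _) (le_max_left _ _) hg'.le hgL').trans ?_
        exact mul_le_mul_of_nonneg_right (le_max_right _ _) hm0
  have hs : IsComplete s := (isCompact_Icc.prod isCompact_Icc).isComplete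
  obtain ⟨⟨x, y⟩, hz, hfix, -⟩ := ContractingWith.exists_fixedPoint' hs hT hK
    (x := ((0:ℝ), (0:ℝ))) (by simp [s]) (edist_ne_top _ _)
  have h1 : x + g * tipG p q u v x y = x := congrArg Prod.fst hfix
  have h2 : y + g' * tipG p' q' u' v' y x = y := congrArg Prod.snd hfix
  refine ⟨x, y, hz.1, hz.2, ?_, ?_⟩
  · have : g * tipG p q u v x y = 0 := by linarith
    exact (mul_eq_zero.mp this).resolve_left hg.ne'
  · have : g' * tipG p' q' u' v' y x = 0 := by linarith
    exact (mul_eq_zero.mp this).resolve_left hg'.ne'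

lemma tip_decay (W : ℕ → ℝ) (hW : ∀ j, 0 ≤ W j) (c : ℝ) (hc : 0 < c) (J : ℕ)
    (h : ∀ j ≥ J, W (j+1) ≤ (1 - c / ((j:ℝ)+1)) * W j) : Tendsto W atTop (nhds 0) := by
  let S : ℕ → ℝ := fun j => ∑ i ∈ Finset.range j, 1 / ((i:ℝ)+1)
  have hS : Tendsto S atTop atTop := Real.tendsto_sum_range_one_div_nat_succ_atTop
  have hZ : ∀ j ≥ J, W j * Real.exp (c * S j) ≤ W J * Real.exp (c * S J) := by
    intro j hj
    induction j, hj using Nat.le_induction with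
    | base => exact le_rfl
    | succ j hj ih =>
      refine le_trans ?_ ih
      have e : c * S (j+1) = c * S j + c / ((j:ℝ)+1) := by
        simp only [S, Finset.sum_range_succ]; ring
      rw [e, Real.exp_add]
      have h1 : 1 - c / ((j:ℝ)+1) ≤ Real.exp (-(c / ((j:ℝ)+1))) := by
        have := Real.add_one_le_exp (-(c / ((j:ℝ)+1)))
        linarith
      have h2 : W (j+1) ≤ Real.exp (-(c / ((j:ℝ)+1))) * W j :=
        (h j hj).trans (mul_le_mul_of_nonneg_right h1 (hW j))
      calc _ ≤ (Real.exp (-(c / ((j:ℝ)+1))) * W j) * (Real.exp (c * S j) * Real.exp (c / ((j:ℝ)+1))) := by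
            gcongr
        _ = W j * Real.exp (c * S j) * (Real.exp (-(c / ((j:ℝ)+1))) * Real.exp (c / ((j:ℝ)+1))) := by ring
        _ = _ := by rw [← Real.exp_add]; simp
  have hlim : Tendsto (fun j => W J * Real.exp (c * S J) * Real.exp (-(c * S j))) atTop (nhds 0) := by
    have : Tendsto (fun j => Real.exp (-(c * S j))) atTop (nhds 0) :=
      Real.tendsto_exp_neg_atTop_nhds_zero.comp (hS.const_mul_atTop hc)
    simpa using this.const_mul (W J * Real.exp (c * S J))
  refine squeeze_zero' (Eventually.of_forall hW) ?_ hlim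
  filter_upwards [eventually_ge_atTop J] with j hj
  have := hZ j hj
  calc W j = W j * Real.exp (c * S j) * Real.exp (-(c * S j)) := by
        rw [mul_assoc, ← Real.exp_add]; simp
    _ ≤ _ := by gcongr

lemma tip_comp (p q u v x y xs ys V g e k ε c : ℝ) (hp : 0 < p) (hq : 0 < q)
    (hu : 0 ≤ u) (hv : 0 ≤ v)
    (hx : x ∈ Set.Icc (0:ℝ) 1) (hx' : xs ∈ Set.Icc (0:ℝ) 1)
    (hy' : ys ∈ Set.Icc (0:ℝ) 1) (hV1 : |x - xs| ≤ V) (hV2 : |y - ys| ≤ V)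
    (hg : 0 ≤ g) (hgL : g * (p + q + 2 * (u + v)) ≤ 1) (h0 : tipG p q u v xs ys = 0)
    (hk : 0 < k) (hkp : k ≤ p + q) (he : |e| ≤ k * ε) (hc : c ≤ g) :
    |x + g * (tipG p q u v x y + e) - xs| - ε ≤ (1 - k * c) * max (V - ε) 0
      ∧ 0 ≤ (1 - k * c) * max (V - ε) 0 := by
  have h := tipG_contract p q u v x y xs ys V g hp hq hu hv hx hx' hy' hV1 hV2 hg hgL
  rw [h0] at h
  have hV : 0 ≤ V := (abs_nonneg _).trans hV1
  have hm0 : 0 ≤ max (V - ε) 0 := le_max_right _ _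
  have hm1 : V - ε ≤ max (V - ε) 0 := le_max_left _ _
  have hgk : g * k ≤ g * (p + q) := mul_le_mul_of_nonneg_left hkp hg
  have hgk1 : g * k ≤ 1 := by
    refine le_trans (mul_le_mul_of_nonneg_left ?_ hg) hgL
    linarith
  have hkc : k * c ≤ g * k := by nlinarith
  have e1 : x + g * (tipG p q u v x y + e) - xs
      = (x + g * tipG p q u v x y - (xs + g * 0)) + g * e := by ring
  have h2 : |x + g * (tipG p q u v x y + e) - xs| ≤ (1 - g * (p+q)) * V + g * (k * ε) := by
    rw [e1]
    refine (abs_add_le _ _).trans (add_le_add h ?_)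
    rw [abs_mul, abs_of_nonneg hg]
    exact mul_le_mul_of_nonneg_left he hg
  refine ⟨?_, mul_nonneg (by linarith) hm0⟩
  have h3 : (1 - g * (p+q)) * V ≤ (1 - g * k) * V := mul_le_mul_of_nonneg_right (by linarith) hV
  have h4 : (1 - g * k) * (V - ε) ≤ (1 - g * k) * max (V - ε) 0 :=
    mul_le_mul_of_nonneg_left hm1 (by linarith)
  have h5 : (1 - g * k) * max (V - ε) 0 ≤ (1 - k * c) * max (V - ε) 0 :=
    mul_le_mul_of_nonneg_right (by linarith) hm0
  nlinarith

lemma tip_conv2 (p q u v p' q' u' v' : ℝ) (hp : 0 < p) (hq : 0 < q)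
    (hu : 0 ≤ u) (hv : 0 ≤ v) (hp' : 0 < p') (hq' : 0 < q')
    (hu' : 0 ≤ u') (hv' : 0 ≤ v') (X Y : ℕ → ℝ)
    (hX : ∀ j, X j ∈ Set.Icc (0:ℝ) 1) (hY : ∀ j, Y j ∈ Set.Icc (0:ℝ) 1)
    (g g' e e' : ℕ → ℝ) (c c' : ℝ) (hc : 0 < c) (hc' : 0 < c')
    (hcg : ∀ j : ℕ, c / ((j:ℝ)+1) ≤ g j) (hcg' : ∀ j : ℕ, c' / ((j:ℝ)+1) ≤ g' j)
    (hg : Tendsto g atTop (nhds 0)) (hg' : Tendsto g' atTop (nhds 0))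
    (he : Tendsto e atTop (nhds 0)) (he' : Tendsto e' atTop (nhds 0))
    (hXs : ∀ j, X (j+1) = X j + g j * (tipG p q u v (X j) (Y j) + e j))
    (hYs : ∀ j, Y (j+1) = Y j + g' j * (tipG p' q' u' v' (Y j) (X j) + e' j)) :
    ∃ x y : ℝ, Tendsto X atTop (nhds x) ∧ Tendsto Y atTop (nhds y) := by
  obtain ⟨xs, ys, hxs, hys, h1, h2⟩ := tip_fixed p q u v p' q' u' v' hp hq hu hv hp' hq' hu' hv'
  let V : ℕ → ℝ := fun j => max |X j - xs| |Y j - ys|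
  let k := min (p+q) (p'+q')
  have hk : 0 < k := lt_min (by linarith) (by linarith)
  let d := min c c'
  have hd : 0 < d := lt_min hc hc'
  have key : ∀ ε > 0, ∀ᶠ j in atTop, V j < 2 * ε := by
    intro ε hε
    have q1 : ∀ᶠ j in atTop, g j * (p + q + 2 * (u + v)) < 1 := by
      have := hg.mul_const (p + q + 2 * (u + v))
      rw [zero_mul] at this
      exact this.eventually_lt_const one_pos
    have q2 : ∀ᶠ j in atTop, g' j * (p' + q' + 2 * (u' + v')) < 1 := by
      have := hg'.mul_const (p' + q' + 2 * (u' + v'))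
      rw [zero_mul] at this
      exact this.eventually_lt_const one_pos
    have q3 : ∀ᶠ j in atTop, |e j| < k * ε := by
      have := he.abs
      rw [abs_zero] at this
      exact this.eventually_lt_const (by positivity)
    have q4 : ∀ᶠ j in atTop, |e' j| < k * ε := by
      have := he'.abs
      rw [abs_zero] at this
      exact this.eventually_lt_const (by positivity)
    obtain ⟨J, hJ⟩ := eventually_atTop.mp (q1.and (q2.and (q3.and q4)))
    have hW := tip_decay (fun j => max (V j - ε) 0) (fun j => le_max_right _ _) (k * d)
      (by positivity) J ?_
    · filter_upwards [hW.eventually_lt_const hε] with j hj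
      have := (le_max_left _ _).trans_lt hj
      linarith
    · intro j hj
      obtain ⟨r1, r2, r3, r4⟩ := hJ j hj
      have hj1 : (0:ℝ) < (j:ℝ) + 1 := by positivity
      have d1 : d / ((j:ℝ)+1) ≤ g j :=
        le_trans (by gcongr; exact min_le_left _ _) (hcg j)
      have d2 : d / ((j:ℝ)+1) ≤ g' j :=
        le_trans (by gcongr; exact min_le_right _ _) (hcg' j)
      have d0 : 0 ≤ d / ((j:ℝ)+1) := by positivity
      obtain ⟨A, A0⟩ := tip_comp p q u v (X j) (Y j) xs ys (V j) (g j) (e j) k ε (d / ((j:ℝ)+1))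
        hp hq hu hv (hX j) hxs hys (le_max_left _ _) (le_max_right _ _) (d0.trans d1) r1.le h1 hk
        (min_le_left _ _) r3.le d1
      obtain ⟨B, -⟩ := tip_comp p' q' u' v' (Y j) (X j) ys xs (V j) (g' j) (e' j) k ε (d / ((j:ℝ)+1))
        hp' hq' hu' hv' (hY j) hys hxs (le_max_right _ _) (le_max_left _ _) (d0.trans d2) r2.le h2 hk
        (min_le_right _ _) r4.le d2
      rw [← hXs] at A
      rw [← hYs] at B
      rw [mul_div_assoc]
      refine max_le ?_ A0
      have : V (j+1) ≤ (1 - k * (d / ((j:ℝ)+1))) * max (V j - ε) 0 + ε :=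
        max_le (by linarith) (by linarith)
      linarith
  refine ⟨xs, ys, ?_, ?_⟩
  · rw [Metric.tendsto_atTop']
    intro ε hε
    obtain ⟨J, hJ⟩ := eventually_atTop.mp (key (ε/2) (by linarith))
    refine ⟨J, fun j hj => ?_⟩
    have := (le_max_left _ _).trans_lt (hJ j hj.le)
    rw [Real.dist_eq]; linarith
  · rw [Metric.tendsto_atTop']
    intro ε hε
    obtain ⟨J, hJ⟩ := eventually_atTop.mp (key (ε/2) (by linarith))
    refine ⟨J, fun j hj => ?_⟩
    have := (le_max_right _ _).trans_lt (hJ j hj.le)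
    rw [Real.dist_eq]; linarith

structure TipAgent (N : ℕ) (P : ℕ → Prop) (α β u v : ℝ) (ν a b mu : ℕ → ℝ) : Prop where
  hN : 0 < N
  hP : ∃ i < N, P i
  hα : 0 < α
  hβ : 0 < β
  hu : 0 ≤ u
  hv : 0 ≤ v
  hν : ∀ k, ν k ∈ Set.Icc (0:ℝ) 1
  ha0 : 0 < a 0
  hb0 : 0 < b 0
  hmu : ∀ k, mu k = a k / (a k + b k)
  hd : ∀ k, P (k % N) → a (k+1) = a k + α ∧ b (k+1) = b k + β
  hi : ∀ k, ¬ P (k % N) → a (k+1) = a k + u * max (ν (k+1) - mu k) 0 ∧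
    b (k+1) = b k + v * max (mu k - ν (k+1)) 0

lemma tip_ratio_mem {a b : ℝ} (ha : 0 < a) (hb : 0 < b) : a / (a + b) ∈ Set.Icc (0:ℝ) 1 := by
  constructor
  · positivity
  · rw [div_le_one (by positivity)]; linarith

lemma tip_ratio_step {a b a' b' : ℝ} (h : 0 < a + b) (h' : 0 < a' + b') :
    a' / (a' + b') = a / (a + b) + 1 / (a' + b') *
      ((1 - a / (a + b)) * (a' - a) - a / (a + b) * (b' - b)) := by
  field_simp
  ring

namespace TipAgent

variable {N : ℕ} {P : ℕ → Prop} {α β u v : ℝ} {ν a b mu : ℕ → ℝ}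

lemma mono (h : TipAgent N P α β u v ν a b mu) (k : ℕ) : a k ≤ a (k+1) ∧ b k ≤ b (k+1) := by
  by_cases hk : P (k % N)
  · obtain ⟨h1, h2⟩ := h.hd k hk
    have := h.hα
    have := h.hβ
    constructor <;> linarith
  · obtain ⟨h1, h2⟩ := h.hi k hk
    have := mul_nonneg h.hu (le_max_right (ν (k+1) - mu k) 0)
    have := mul_nonneg h.hv (le_max_right (mu k - ν (k+1)) 0)
    constructor <;> linarith

lemma pos (h : TipAgent N P α β u v ν a b mu) (k : ℕ) : 0 < a k ∧ 0 < b k := by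
  induction k with
  | zero => exact ⟨h.ha0, h.hb0⟩
  | succ k ih => exact ⟨ih.1.trans_le (h.mono k).1, ih.2.trans_le (h.mono k).2⟩

lemma mem (h : TipAgent N P α β u v ν a b mu) (k : ℕ) : mu k ∈ Set.Icc (0:ℝ) 1 := by
  rw [h.hmu]; exact tip_ratio_mem (h.pos k).1 (h.pos k).2

lemma inc (h : TipAgent N P α β u v ν a b mu) (k : ℕ) :
    a (k+1) - a k ≤ α + β + u + v ∧ b (k+1) - b k ≤ α + β + u + v := by
  have := h.hα
  have := h.hβ
  have := h.hu
  have := h.hv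
  by_cases hk : P (k % N)
  · obtain ⟨h1, h2⟩ := h.hd k hk
    constructor <;> linarith
  · obtain ⟨h1, h2⟩ := h.hi k hk
    obtain ⟨m0, m1⟩ := h.mem k
    obtain ⟨n0, n1⟩ := h.hν (k+1)
    have := mul_le_mul_of_nonneg_left (max_le (by linarith) zero_le_one : max (ν (k+1) - mu k) 0 ≤ 1) h.hu
    have := mul_le_mul_of_nonneg_left (max_le (by linarith) zero_le_one : max (mu k - ν (k+1)) 0 ≤ 1) h.hv
    constructor <;> linarith

lemma lower (h : TipAgent N P α β u v ν a b mu) (j : ℕ) : α * j ≤ a (j * N) := by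
  have hm : Monotone a := monotone_nat_of_le_succ fun k => (h.mono k).1
  induction j with
  | zero => simpa using h.ha0.le
  | succ j ih =>
    obtain ⟨i, hi, hPi⟩ := h.hP
    have e : (j * N + i) % N = i := by
      rw [Nat.add_comm, Nat.add_mul_mod_self_right, Nat.mod_eq_of_lt hi]
    have h1 := (h.hd (j * N + i) (by rw [e]; exact hPi)).1
    have h2 : a (j * N) ≤ a (j * N + i) := hm (Nat.le_add_right _ _)
    have h3 : a (j * N + i + 1) ≤ a ((j+1) * N) := hm (by rw [Nat.add_mul]; omega)
    push_cast
    linarith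

lemma upper (h : TipAgent N P α β u v ν a b mu) (k : ℕ) :
    a k + b k ≤ a 0 + b 0 + 2 * (α + β + u + v) * k := by
  induction k with
  | zero => simp
  | succ k ih =>
    have := h.inc k
    push_cast
    linarith

lemma top (h : TipAgent N P α β u v ν a b mu) : Tendsto (fun k => a k + b k) atTop atTop := by
  have hm : Monotone a := monotone_nat_of_le_succ fun k => (h.mono k).1
  have h1 : Tendsto a atTop atTop := by
    refine tendsto_atTop_atTop_of_monotone hm fun B => ?_
    obtain ⟨j, hj⟩ := exists_nat_ge (B / α)
    refine ⟨j * N, le_trans ?_ (h.lower j)⟩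
    rw [div_le_iff₀ h.hα] at hj
    linarith
  exact tendsto_atTop_mono (fun k => by linarith [(h.pos k).2]) h1

lemma slow (h : TipAgent N P α β u v ν a b mu) :
    Tendsto (fun k => mu (k+1) - mu k) atTop (nhds 0) := by
  have ht : Tendsto (fun k => (α + β + u + v) / (a (k+1) + b (k+1))) atTop (nhds 0) :=
    ((h.top).comp (tendsto_add_atTop_nat 1)).const_div_atTop _
  refine squeeze_zero_norm (fun k => ?_) ht
  obtain ⟨p1, p2⟩ := h.pos k
  obtain ⟨p3, p4⟩ := h.pos (k+1)
  have hs := tip_ratio_step (a := a k) (b := b k) (a' := a (k+1)) (b' := b (k+1))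
    (by linarith) (by linarith)
  rw [← h.hmu, ← h.hmu] at hs
  have e : mu (k+1) - mu k = ((1 - mu k) * (a (k+1) - a k) - mu k * (b (k+1) - b k)) / (a (k+1) + b (k+1)) := by
    rw [hs]; ring
  rw [e, norm_div, Real.norm_eq_abs, Real.norm_eq_abs, abs_of_pos (show 0 < a (k+1) + b (k+1) by linarith)]
  gcongr
  obtain ⟨m0, m1⟩ := h.mem k
  obtain ⟨i1, i2⟩ := h.inc k
  obtain ⟨i3, i4⟩ := h.mono k
  have t1 : 0 ≤ (1 - mu k) * (a (k+1) - a k) := mul_nonneg (by linarith) (by linarith)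
  have t2 : 0 ≤ mu k * (b (k+1) - b k) := mul_nonneg (by linarith) (by linarith)
  have t3 : (1 - mu k) * (a (k+1) - a k) ≤ 1 * (α + β + u + v) :=
    mul_le_mul (by linarith) i1 (by linarith) (by linarith)
  have t4 : mu k * (b (k+1) - b k) ≤ 1 * (α + β + u + v) :=
    mul_le_mul (by linarith) i2 (by linarith) (by linarith)
  rw [abs_le]
  constructor <;> linarith

end TipAgent

lemma tip_shift (f : ℕ → ℝ) (hf : Tendsto (fun k => f (k+1) - f k) atTop (nhds 0))
    (N : ℕ) (hN : 0 < N) (i : ℕ) :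
    Tendsto (fun j => f (j * N + i) - f (j * N)) atTop (nhds 0) := by
  induction i with
  | zero => simp
  | succ i ih =>
    have ht : Tendsto (fun j => j * N + i) atTop atTop :=
      tendsto_atTop_mono (fun j => (Nat.le_mul_of_pos_right j hN).trans (Nat.le_add_right _ _)) tendsto_id
    have := (hf.comp ht).add ih
    simp only [add_zero] at this
    refine this.congr fun j => ?_
    simp only [Function.comp]
    rw [← Nat.add_assoc]
    ring

lemma tip_unshift (f : ℕ → ℝ) (hf : Tendsto (fun k => f (k+1) - f k) atTop (nhds 0))
    (N : ℕ) (hN : 0 < N) (x : ℝ) (hx : Tendsto (fun j => f (j * N)) atTop (nhds x)) :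
    Tendsto f atTop (nhds x) := by
  have h1 : ∀ i, Tendsto (fun j => f (j * N + i)) atTop (nhds x) := by
    intro i
    have := (tip_shift f hf N hN i).add hx
    simpa using this
  rw [tendsto_def]
  intro s hs
  have h2 : ∀ᶠ j in atTop, ∀ i ∈ Finset.range N, f (j * N + i) ∈ s :=
    (Finset.eventually_all _).mpr fun i _ => (h1 i).eventually_mem hs
  obtain ⟨J, hJ⟩ := eventually_atTop.mp h2
  refine mem_atTop_sets.mpr ⟨J * N, fun k hk => ?_⟩
  have h3 := hJ (k / N) ((Nat.le_div_iff_mul_le hN).mpr hk) (k % N)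
    (Finset.mem_range.mpr (Nat.mod_lt _ hN))
  rwa [Nat.mul_comm, Nat.div_add_mod] at h3

lemma tip_period (N : ℕ) (hN : 0 < N) (P : ℕ → Prop) [DecidablePred P] (α u : ℝ)
    (c d a : ℕ → ℝ)
    (hc : Tendsto (fun k => c (k+1) - c k) atTop (nhds 0))
    (hd : Tendsto (fun k => d (k+1) - d k) atTop (nhds 0))
    (t : ℕ) (s : ℕ)
    (h1 : ∀ k, P (k % N) → a (k+1) = a k + α)
    (h2 : ∀ k, ¬ P (k % N) → a (k+1) = a k + u * max (c (k+s) - d (k+t)) 0) :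
    Tendsto (fun j => a ((j+1) * N) - a (j * N) -
      ((((Finset.range N).filter P).card : ℝ) * α +
       (((Finset.range N).filter (fun i => ¬ P i)).card * u) * max (c (j * N) - d (j * N)) 0))
      atTop (nhds 0) := by
  have e : ∀ j, a ((j+1) * N) - a (j * N) -
      ((((Finset.range N).filter P).card : ℝ) * α +
       (((Finset.range N).filter (fun i => ¬ P i)).card * u) * max (c (j * N) - d (j * N)) 0)
      = ∑ i ∈ Finset.range N, (a (j * N + i + 1) - a (j * N + i) -
        (if P i then α else u * max (c (j * N) - d (j * N)) 0)) := by
    intro j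
    rw [Finset.sum_sub_distrib, Finset.sum_ite, Finset.sum_const, Finset.sum_const]
    have := Finset.sum_range_sub (fun i => a (j * N + i)) N
    simp only [← Nat.add_assoc] at this
    rw [this, Nat.add_mul]
    simp only [nsmul_eq_mul, one_mul, add_zero]
    ring
  simp only [e]
  have hz : (0:ℝ) = ∑ _i ∈ Finset.range N, (0:ℝ) := by simp
  suffices hsuf : ∀ i ∈ Finset.range N, Tendsto (fun j => a (j * N + i + 1) - a (j * N + i) -
        (if P i then α else u * max (c (j * N) - d (j * N)) 0)) atTop (nhds 0) by
    have := tendsto_finsetSum _ hsuf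
    rwa [← hz] at this
  intro i hi
  have hi := Finset.mem_range.mp hi
  have em : ∀ j, (j * N + i) % N = i := fun j => by
    rw [Nat.add_comm, Nat.add_mul_mod_self_right, Nat.mod_eq_of_lt hi]
  by_cases hPi : P i
  · refine tendsto_const_nhds.congr fun j => ?_
    rw [h1 (j * N + i) (by rw [em]; exact hPi), if_pos hPi]; ring
  · have hcs := tip_shift c hc N hN (i+s)
    have hds := tip_shift d hd N hN (i+t)
    have h3 := ((hcs.sub hds).abs).const_mul |u|
    simp only [sub_zero, abs_zero, mul_zero] at h3
    refine squeeze_zero_norm (fun j => ?_) h3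
    rw [h2 (j * N + i) (by rw [em]; exact hPi), if_neg hPi, Real.norm_eq_abs]
    have : a (j * N + i) + u * max (c (j * N + i + s) - d (j * N + i + t)) 0 - a (j * N + i) -
      u * max (c (j * N) - d (j * N)) 0 = u * (max (c (j * N + i + s) - d (j * N + i + t)) 0
        - max (c (j * N) - d (j * N)) 0) := by ring
    rw [this, abs_mul]
    refine mul_le_mul_of_nonneg_left ?_ (abs_nonneg _)
    refine (abs_max_sub_max_le_abs _ _ _).trans (le_of_eq ?_)
    rw [← Nat.add_assoc, ← Nat.add_assoc]
    congr 1
    ring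

lemma TipAgent.recur {N : ℕ} {P : ℕ → Prop} [DecidablePred P] {α β u v : ℝ}
    {ν a b mu : ℕ → ℝ}
    (h : TipAgent N P α β u v ν a b mu)
    (hν : Tendsto (fun k => ν (k+1) - ν k) atTop (nhds 0)) :
    ∃ p q u' v' c : ℝ, ∃ g e : ℕ → ℝ, 0 < p ∧ 0 < q ∧ 0 ≤ u' ∧ 0 ≤ v' ∧ 0 < c ∧
      (∀ j : ℕ, c / ((j:ℝ)+1) ≤ g j) ∧ Tendsto g atTop (nhds 0) ∧ Tendsto e atTop (nhds 0) ∧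
      ∀ j, mu ((j+1) * N) = mu (j * N) +
        g j * (tipG p q u' v' (mu (j * N)) (ν (j * N)) + e j) := by
  have hN := h.hN
  have hA := tip_period N hN P α u ν mu a hν h.slow 0 1 (fun k hk => (h.hd k hk).1)
    (fun k hk => (h.hi k hk).1)
  have hB := tip_period N hN P β v mu ν b h.slow hν 1 0 (fun k hk => (h.hd k hk).2)
    (fun k hk => (h.hi k hk).2)
  set M : ℝ := (((Finset.range N).filter P).card : ℝ) with hM
  set M' : ℝ := (((Finset.range N).filter (fun i => ¬ P i)).card : ℝ) with hM'
  have hMpos : 0 < M := by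
    obtain ⟨i, hi, hPi⟩ := h.hP
    rw [hM, Nat.cast_pos, Finset.card_pos]
    exact ⟨i, by simp [hi, hPi]⟩
  have hM'0 : 0 ≤ M' := Nat.cast_nonneg _
  set ea := fun j => a ((j+1) * N) - a (j * N) -
      (M * α + (M' * u) * max (ν (j * N) - mu (j * N)) 0) with hea
  set eb := fun j => b ((j+1) * N) - b (j * N) -
      (M * β + (M' * v) * max (mu (j * N) - ν (j * N)) 0) with heb
  have hα := h.hα
  have hβ := h.hβ
  have hu := h.hu
  have hv := h.hv
  have ha0 := h.ha0
  have hb0 := h.hb0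
  refine ⟨M * α, M * β, M' * u, M' * v,
    1 / (a 0 + b 0 + 2 * (α + β + u + v) * N),
    fun j => 1 / (a ((j+1) * N) + b ((j+1) * N)),
    fun j => (1 - mu (j * N)) * ea j - mu (j * N) * eb j,
    by positivity, by positivity, by positivity, by positivity, by positivity, ?_, ?_, ?_, ?_⟩
  · intro j
    obtain ⟨p1, p2⟩ := h.pos ((j+1) * N)
    rw [div_div]
    apply one_div_le_one_div_of_le (by linarith)
    have := h.upper ((j+1) * N)
    push_cast at this
    have hj : 0 ≤ (a 0 + b 0) * (j : ℝ) := by positivity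
    linarith
  · have ht : Tendsto (fun j => (j+1) * N) atTop atTop :=
      tendsto_atTop_mono (fun j => (Nat.le_succ j).trans (Nat.le_mul_of_pos_right (j+1) hN)) tendsto_id
    exact (h.top.comp ht).const_div_atTop 1
  · have hl : Tendsto (fun j => |ea j| + |eb j|) atTop (nhds 0) := by
      simpa using hA.abs.add hB.abs
    refine squeeze_zero_norm (fun j => ?_) hl
    obtain ⟨m0, m1⟩ := h.mem (j * N)
    rw [Real.norm_eq_abs]
    refine (abs_sub _ _).trans (add_le_add ?_ ?_)
    · rw [abs_mul, abs_of_nonneg (by linarith : 0 ≤ 1 - mu (j * N))]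
      exact mul_le_of_le_one_left (abs_nonneg _) (by linarith)
    · rw [abs_mul, abs_of_nonneg m0]
      exact mul_le_of_le_one_left (abs_nonneg _) (by linarith)
  · intro j
    obtain ⟨p1, p2⟩ := h.pos (j * N)
    obtain ⟨p3, p4⟩ := h.pos ((j+1) * N)
    have hs := tip_ratio_step (a := a (j * N)) (b := b (j * N)) (a' := a ((j+1) * N))
      (b' := b ((j+1) * N)) (by linarith) (by linarith)
    rw [← h.hmu, ← h.hmu] at hs
    rw [hs, hea, heb]
    unfold tipG
    ring

lemma tip_two {N : ℕ} {P Q : ℕ → Prop} {α β u v α' β' u' v' : ℝ}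
    {a b mu a' b' mu' : ℕ → ℝ}
    (h : TipAgent N P α β u v mu' a b mu) (h' : TipAgent N Q α' β' u' v' mu a' b' mu') :
    ∃ x y : ℝ, Tendsto mu atTop (nhds x) ∧ Tendsto mu' atTop (nhds y) := by
  classical
  obtain ⟨p, q, w, z, c, g, e, hp, hq, hw, hz, hc, hcg, hg, he, hr⟩ := h.recur h'.slow
  obtain ⟨p', q', w', z', c', g', e', hp', hq', hw', hz', hc', hcg', hg', he', hr'⟩ := h'.recur h.slow
  obtain ⟨x, y, hx, hy⟩ := tip_conv2 p q w z p' q' w' z' hp hq hw hz hp' hq' hw' hz'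
    (fun j => mu (j * N)) (fun j => mu' (j * N)) (fun j => h.mem _) (fun j => h'.mem _)
    g g' e e' c c' hc hc' hcg hcg' hg hg' he he' hr hr'
  exact ⟨x, y, tip_unshift mu h.slow N h.hN x hx, tip_unshift mu' h'.slow N h.hN y hy⟩

lemma tip_follow_half (a b M : ℕ → ℝ) (u v t : ℝ) (hu : 0 ≤ u) (hv : 0 ≤ v)
    (ha : ∀ k, 0 < a k) (hb : ∀ k, 0 < b k) (hM : Tendsto M atTop (nhds t)) (ht : t ≤ 1)
    (hD : Tendsto (fun k => a k + b k) atTop atTop)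
    (h1 : ∀ k, a (k+1) = a k + u * max (M k - a k / (a k + b k)) 0)
    (h2 : ∀ k, b (k+1) = b k + v * max (a k / (a k + b k) - M k) 0)
    (ε : ℝ) (hε : 0 < ε) : ∀ᶠ k in atTop, t - ε ≤ a k / (a k + b k) := by
  obtain ⟨K, hK⟩ := eventually_atTop.mp
    ((hM.eventually_const_lt (show t - ε < t by linarith)).and (hD.eventually_ge_atTop v))
  have stay : ∀ k ≥ K, t - ε ≤ a k / (a k + b k) → t - ε ≤ a (k+1) / (a (k+1) + b (k+1)) := by
    intro k hk hle
    obtain ⟨k1, k2⟩ := hK k hk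
    have pa := ha k
    have pb := hb k
    have pa' := ha (k+1)
    have pb' := hb (k+1)
    have hs := tip_ratio_step (a := a k) (b := b k) (a' := a (k+1)) (b' := b (k+1))
      (by linarith) (by linarith)
    obtain ⟨m0, m1⟩ := tip_ratio_mem pa pb
    have e1 := h1 k
    have e2 := h2 k
    set x := a k / (a k + b k)
    have hg : 0 < 1 / (a (k+1) + b (k+1)) := by positivity
    rcases le_total x (M k) with hx | hx
    · rw [max_eq_right (by linarith : x - M k ≤ 0)] at e2
      have d1 : 0 ≤ a (k+1) - a k := by
        rw [e1]; have := mul_nonneg hu (le_max_right (M k - x) 0); linarith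
      have d2 : b (k+1) - b k = 0 := by rw [e2]; ring
      rw [hs, d2]
      have := mul_nonneg hg.le (mul_nonneg (by linarith : 0 ≤ 1 - x) d1)
      linarith
    · rw [max_eq_right (by linarith : M k - x ≤ 0)] at e1
      rw [max_eq_left (by linarith : 0 ≤ x - M k)] at e2
      have d1 : a (k+1) - a k = 0 := by rw [e1]; ring
      have d2 : b (k+1) - b k = v * (x - M k) := by rw [e2]; ring
      rw [hs, d1, d2]
      have d3 : 0 ≤ v * (x - M k) := mul_nonneg hv (by linarith)
      have hle1 : 1 / (a (k+1) + b (k+1)) * v ≤ 1 := by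
        rw [one_div_mul_eq_div, div_le_one (by linarith)]
        linarith
      have hle2 : 1 / (a (k+1) + b (k+1)) * v * x ≤ 1 :=
        mul_le_one₀ hle1 m0 m1
      have := mul_le_mul_of_nonneg_right hle2 (by linarith : 0 ≤ x - M k)
      nlinarith
  by_cases hex : ∃ k ≥ K, t - ε ≤ a k / (a k + b k)
  · obtain ⟨k0, hk0, hin⟩ := hex
    refine eventually_atTop.mpr ⟨k0, fun k hk => ?_⟩
    induction k, hk using Nat.le_induction with
    | base => exact hin
    | succ k hk ih => exact stay k (hk0.trans hk) ih
  · exfalso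
    push Not at hex
    have hbc : ∀ k ≥ K, b k = b K := by
      intro k hk
      induction k, hk using Nat.le_induction with
      | base => rfl
      | succ k hk ih =>
        rw [h2, max_eq_right, mul_zero, add_zero, ih]
        have := hex k hk
        have := (hK k hk).1
        linarith
    have hlim : Tendsto (fun k => 1 - b K / (a k + b k)) atTop (nhds (1 - 0)) :=
      tendsto_const_nhds.sub (hD.const_div_atTop _)
    have hev : ∀ᶠ k in atTop, 1 - b K / (a k + b k) ≤ t - ε := by
      filter_upwards [eventually_ge_atTop K] with k hk
      have h3 := hex k hk
      have : 1 - b K / (a k + b k) = a k / (a k + b k) := by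
        have pa := ha k
        have pb := hb k
        rw [← hbc k hk]; field_simp; ring
      linarith
    have := le_of_tendsto hlim hev
    linarith

lemma tip_follow (a b M : ℕ → ℝ) (u v t : ℝ) (hu : 0 ≤ u) (hv : 0 ≤ v)
    (ha : ∀ k, 0 < a k) (hb : ∀ k, 0 < b k) (hM : Tendsto M atTop (nhds t)) (ht0 : 0 ≤ t)
    (ht : t ≤ 1)
    (h1 : ∀ k, a (k+1) = a k + u * max (M k - a k / (a k + b k)) 0)
    (h2 : ∀ k, b (k+1) = b k + v * max (a k / (a k + b k) - M k) 0) :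
    ∃ y, Tendsto (fun k => a k / (a k + b k)) atTop (nhds y) := by
  have ma : Monotone a := monotone_nat_of_le_succ fun k => by
    rw [h1]; linarith [mul_nonneg hu (le_max_right (M k - a k / (a k + b k)) 0)]
  have mb : Monotone b := monotone_nat_of_le_succ fun k => by
    rw [h2]; linarith [mul_nonneg hv (le_max_right (a k / (a k + b k) - M k) 0)]
  have mD : Monotone (fun k => a k + b k) := ma.add mb
  rcases tendsto_atTop_of_monotone mD with hD | ⟨l, hl⟩
  · refine ⟨t, ?_⟩
    have c : ∀ k, b k / (b k + a k) = 1 - a k / (a k + b k) := fun k => by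
      have pa := ha k
      have pb := hb k
      field_simp; ring
    rw [Metric.tendsto_nhds]
    intro ε hε
    have A := tip_follow_half a b M u v t hu hv ha hb hM ht hD h1 h2 (ε/2) (by linarith)
    have B := tip_follow_half b a (fun k => 1 - M k) v u (1 - t) hv hu hb ha
      (tendsto_const_nhds.sub hM) (by linarith) (by simpa only [add_comm] using hD)
      (fun k => by rw [h2, c]; congr 3; ring) (fun k => by rw [h1, c]; congr 3; ring)
      (ε/2) (by linarith)
    filter_upwards [A, B] with k hA hB
    rw [c] at hB
    rw [Real.dist_eq, abs_lt]
    constructor <;> linarith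
  · have hle : ∀ k, a k + b k ≤ l := fun k => mD.ge_of_tendsto hl k
    have hapos : 0 < l := lt_of_lt_of_le (add_pos (ha 0) (hb 0)) (hle 0)
    have hA := tendsto_atTop_ciSup ma ⟨l, by rintro _ ⟨k, rfl⟩; linarith [hle k, hb k]⟩
    exact ⟨_, hA.div hl hapos.ne'⟩

lemma tip_linear (a b : ℕ → ℝ) (α β : ℝ) (hα : 0 < α) (hβ : 0 < β)
    (ha0 : 0 < a 0) (hb0 : 0 < b 0) (h : ∀ k, a (k+1) = a k + α ∧ b (k+1) = b k + β) :
    Tendsto (fun k => a k / (a k + b k)) atTop (nhds (α / (α + β))) := by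
  have ea : ∀ k : ℕ, a k = a 0 + α * k ∧ b k = b 0 + β * k := by
    intro k
    induction k with
    | zero => simp
    | succ k ih =>
      rw [(h k).1, (h k).2, ih.1, ih.2]; push_cast; constructor <;> ring
  have i1 : Tendsto (fun k : ℕ => a 0 / (k:ℝ) + α) atTop (nhds (0 + α)) :=
    (tendsto_const_div_atTop_nhds_zero_nat _).add_const _
  have i2 : Tendsto (fun k : ℕ => b 0 / (k:ℝ) + β) atTop (nhds (0 + β)) :=
    (tendsto_const_div_atTop_nhds_zero_nat _).add_const _
  have i3 := i1.div (i1.add i2) (by positivity)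
  simp only [zero_add] at i3
  refine i3.congr' ?_
  filter_upwards [eventually_gt_atTop 0] with k hk
  have hk' : (0:ℝ) < k := Nat.cast_pos.mpr hk
  simp only [Pi.div_apply]
  rw [(ea k).1, (ea k).2]
  field_simp

/-- **Convergence of the deterministic mean dynamics of the TIP alternating-interaction
model.** Writing `μx k = ax k/(ax k + bx k)` and `μy k = ay k/(ay k + bY k)`, under the
alternating direct/indirect updates both expected-trust sequences converge. -/
theorem tip_mean_dynamics_converge
    (r : ℝ) (hr : r ∈ Set.Ioo (0 : ℝ) 1)
    (m n : ℕ) (hm : 1 ≤ m)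
    (sx fx sy fy : ℝ) (hsx : 0 < sx) (hfx : 0 < fx) (hsy : 0 < sy) (hfy : 0 < fy)
    (sxh fxh syh fyh : ℝ) (hsxh : 0 < sxh) (hfxh : 0 < fxh) (hsyh : 0 < syh) (hfyh : 0 < fyh)
    (txy tyx : ℝ) (htxy : txy ∈ Set.Ioc (0 : ℝ) 1) (htyx : tyx ∈ Set.Ioc (0 : ℝ) 1)
    (ax bx ay bY : ℕ → ℝ)
    (hax0 : 0 < ax 0) (hbx0 : 0 < bx 0) (hay0 : 0 < ay 0) (hbY0 : 0 < bY 0)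
    -- x-steps: x updates directly, y indirectly (using x's updated expected trust)
    (hxstep : ∀ k, 1 ≤ k → (k - 1) % (m + n) < m →
      ax k = ax (k - 1) + sx * r ∧
      bx k = bx (k - 1) + fx * (1 - r) ∧
      ay k = ay (k - 1) +
        syh * tyx * max (ax k / (ax k + bx k) - ay (k - 1) / (ay (k - 1) + bY (k - 1))) 0 ∧
      bY k = bY (k - 1) +
        fyh * tyx * max (ay (k - 1) / (ay (k - 1) + bY (k - 1)) - ax k / (ax k + bx k)) 0)
    -- y-steps: y updates directly, x indirectly
    (hystep : ∀ k, 1 ≤ k → ¬ (k - 1) % (m + n) < m →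
      ay k = ay (k - 1) + sy * r ∧
      bY k = bY (k - 1) + fy * (1 - r) ∧
      ax k = ax (k - 1) +
        sxh * txy * max (ay k / (ay k + bY k) - ax (k - 1) / (ax (k - 1) + bx (k - 1))) 0 ∧
      bx k = bx (k - 1) +
        fxh * txy * max (ax (k - 1) / (ax (k - 1) + bx (k - 1)) - ay k / (ay k + bY k)) 0) :
    ∃ tx ty : ℝ, tx ∈ Set.Icc (0 : ℝ) 1 ∧ ty ∈ Set.Icc (0 : ℝ) 1 ∧
      Tendsto (fun k => ax k / (ax k + bx k)) atTop (nhds tx) ∧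
      Tendsto (fun k => ay k / (ay k + bY k)) atTop (nhds ty) := by
  obtain ⟨hr0, hr1⟩ := hr
  have hr1' : 0 < 1 - r := by linarith
  obtain ⟨htxy0, -⟩ := htxy
  obtain ⟨htyx0, -⟩ := htyx
  have hX : ∀ k, k % (m + n) < m → _ := fun k hk => hxstep (k+1) (by omega) (by simpa using hk)
  have hY : ∀ k, ¬ k % (m + n) < m → _ := fun k hk => hystep (k+1) (by omega) (by simpa using hk)
  simp only [Nat.add_sub_cancel] at hX hY
  have hpos : ∀ k, 0 < ax k ∧ 0 < bx k ∧ 0 < ay k ∧ 0 < bY k := by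
    intro k
    induction k with
    | zero => exact ⟨hax0, hbx0, hay0, hbY0⟩
    | succ k ih =>
      obtain ⟨i1, i2, i3, i4⟩ := ih
      by_cases hk : k % (m + n) < m
      · obtain ⟨e1, e2, e3, e4⟩ := hX k hk
        refine ⟨by rw [e1]; positivity, by rw [e2]; positivity, ?_, ?_⟩
        · rw [e3]
          exact add_pos_of_pos_of_nonneg i3 (mul_nonneg (by positivity) (le_max_right _ _))
        · rw [e4]
          exact add_pos_of_pos_of_nonneg i4 (mul_nonneg (by positivity) (le_max_right _ _))
      · obtain ⟨e1, e2, e3, e4⟩ := hY k hk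
        refine ⟨?_, ?_, by rw [e1]; positivity, by rw [e2]; positivity⟩
        · rw [e3]
          exact add_pos_of_pos_of_nonneg i1 (mul_nonneg (by positivity) (le_max_right _ _))
        · rw [e4]
          exact add_pos_of_pos_of_nonneg i2 (mul_nonneg (by positivity) (le_max_right _ _))
  have mx : ∀ k, ax k / (ax k + bx k) ∈ Set.Icc (0:ℝ) 1 := fun k =>
    tip_ratio_mem (hpos k).1 (hpos k).2.1
  have my : ∀ k, ay k / (ay k + bY k) ∈ Set.Icc (0:ℝ) 1 := fun k =>
    tip_ratio_mem (hpos k).2.2.1 (hpos k).2.2.2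
  have main : ∃ x y : ℝ, Tendsto (fun k => ax k / (ax k + bx k)) atTop (nhds x) ∧
      Tendsto (fun k => ay k / (ay k + bY k)) atTop (nhds y) := by
    rcases Nat.eq_zero_or_pos n with hn | hn
    · have hall : ∀ k, k % (m + n) < m := fun k => by
        rw [hn, Nat.add_zero]; exact Nat.mod_lt _ hm
      have hx := tip_linear ax bx (sx * r) (fx * (1 - r)) (by positivity) (by positivity) hax0 hbx0
        (fun k => ⟨(hX k (hall k)).1, (hX k (hall k)).2.1⟩)
      obtain ⟨t0, t1⟩ := tip_ratio_mem (mul_pos hsx hr0) (mul_pos hfx hr1')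
      obtain ⟨y, hy⟩ := tip_follow ay bY (fun k => ax (k+1) / (ax (k+1) + bx (k+1)))
        (syh * tyx) (fyh * tyx) _ (by positivity) (by positivity)
        (fun k => (hpos k).2.2.1) (fun k => (hpos k).2.2.2)
        (hx.comp (tendsto_add_atTop_nat 1)) t0 t1
        (fun k => (hX k (hall k)).2.2.1) (fun k => (hX k (hall k)).2.2.2)
      exact ⟨_, y, hx, hy⟩
    · refine tip_two (N := m + n) (P := fun i => i < m) (Q := fun i => ¬ i < m)
        (α := sx * r) (β := fx * (1 - r)) (u := sxh * txy) (v := fxh * txy)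
        (α' := sy * r) (β' := fy * (1 - r)) (u' := syh * tyx) (v' := fyh * tyx)
        (a := ax) (b := bx) (a' := ay) (b' := bY) ?_ ?_
      · exact ⟨by omega, ⟨0, by omega, by omega⟩, by positivity, by positivity, by positivity,
          by positivity, my, hax0, hbx0, fun k => rfl,
          fun k hk => ⟨(hX k hk).1, (hX k hk).2.1⟩,
          fun k hk => ⟨(hY k hk).2.2.1, (hY k hk).2.2.2⟩⟩
      · exact ⟨by omega, ⟨m, by omega, by omega⟩, by positivity, by positivity, by positivity,
          by positivity, mx, hay0, hbY0, fun k => rfl,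
          fun k hk => ⟨(hY k hk).1, (hY k hk).2.1⟩,
          fun k hk => ⟨(hX k (not_not.mp hk)).2.2.1, (hX k (not_not.mp hk)).2.2.2⟩⟩
  obtain ⟨x, y, hx, hy⟩ := main
  exact ⟨x, y, isClosed_Icc.mem_of_tendsto hx (Eventually.of_forall mx),
    isClosed_Icc.mem_of_tendsto hy (Eventually.of_forall my), hx, hy⟩
end

section
/- Fix K ∈ ℕ, data points t_0, …, t_K ∈ (0,1), and nonnegative constants P_k, P̄_k, Q_k, Q̄_k ≥ 0 for k = 0, …, K. For θ = (α_0, β_0, s, f, ŝ, f̂) set α_k(θ) = α_0 + s·P_k + ŝ·Q_k and β_k(θ) = β_0 + f·P̄_k + f̂·Q̄_k. Then the log-likelihood H(θ) = Σ_{k=0}^{K} [ log Γ(α_k(θ)+β_k(θ)) − log Γ(α_k(θ)) − log Γ(β_k(θ)) + (α_k(θ)−1)·log t_k + (β_k(θ)−1)·log(1−t_k) ] is a concave function of θ on the convex set {θ ∈ ℝ⁶ : α_0 > 0, β_0 > 0, s > 0, f > 0, ŝ > 0, f̂ > 0}. -/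
open MeasureTheory in
lemma tip_beta_le {a b x y u v : ℝ} (ha : 0 < a) (hb : 0 < b) (hab : a + b = 1)
    (hx : 0 < x) (hy : 0 < y) (hu : 0 < u) (hv : 0 < v) :
    ProbabilityTheory.beta (a * x + b * u) (a * y + b * v) ≤
      ProbabilityTheory.beta x y ^ a * ProbabilityTheory.beta u v ^ b := by
  have hz : 0 < a * x + b * u := by positivity
  have hw : 0 < a * y + b * v := by positivity
  have B1 := ProbabilityTheory.beta_pos hx hy
  have B2 := ProbabilityTheory.beta_pos hu hv
  have B3 := ProbabilityTheory.beta_pos hz hw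
  have m : ∀ p q : ℝ, Measurable (ProbabilityTheory.betaPDF p q) := fun p q =>
    (ProbabilityTheory.measurable_betaPDFReal p q).ennreal_ofReal
  have h := ENNReal.lintegral_mul_norm_pow_le (μ := (volume : Measure ℝ))
    (m x y).aemeasurable (m u v).aemeasurable ha.le hb.le hab
  rw [ProbabilityTheory.lintegral_betaPDF_eq_one hx hy,
    ProbabilityTheory.lintegral_betaPDF_eq_one hu hv] at h
  have key : ∀ s, ProbabilityTheory.betaPDF x y s ^ a * ProbabilityTheory.betaPDF u v s ^ b
      = ENNReal.ofReal (ProbabilityTheory.beta (a * x + b * u) (a * y + b * v) /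
        (ProbabilityTheory.beta x y ^ a * ProbabilityTheory.beta u v ^ b)) *
        ProbabilityTheory.betaPDF (a * x + b * u) (a * y + b * v) s := by
    intro s
    simp only [ProbabilityTheory.betaPDF_eq]
    split_ifs with hs
    · have h0 := hs.1
      have h1 : 0 < 1 - s := by linarith [hs.2]
      rw [ENNReal.ofReal_rpow_of_pos (by positivity), ENNReal.ofReal_rpow_of_pos (by positivity),
        ← ENNReal.ofReal_mul (by positivity), ← ENNReal.ofReal_mul (by positivity)]
      congr 1
      have e1 : s ^ (a * x + b * u - 1) = (s ^ (x - 1)) ^ a * (s ^ (u - 1)) ^ b := by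
        rw [← Real.rpow_mul h0.le, ← Real.rpow_mul h0.le, ← Real.rpow_add h0]
        congr 1; linear_combination hab
      have e2 : (1 - s) ^ (a * y + b * v - 1) = ((1 - s) ^ (y - 1)) ^ a * ((1 - s) ^ (v - 1)) ^ b := by
        rw [← Real.rpow_mul h1.le, ← Real.rpow_mul h1.le, ← Real.rpow_add h1]
        congr 1; linear_combination hab
      rw [e1, e2, Real.mul_rpow (by positivity) (by positivity),
        Real.mul_rpow (by positivity) (by positivity), Real.mul_rpow (by positivity) (by positivity),
        Real.mul_rpow (by positivity) (by positivity), Real.div_rpow (by positivity) (by positivity),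
        Real.div_rpow (by positivity) (by positivity), Real.one_rpow, Real.one_rpow]
      generalize ProbabilityTheory.beta (a * x + b * u) (a * y + b * v) = B at B3 ⊢
      field_simp
    · simp [ha]
  simp_rw [key] at h
  rw [lintegral_const_mul _ (m _ _), ProbabilityTheory.lintegral_betaPDF_eq_one hz hw] at h
  simp only [mul_one, ENNReal.one_rpow, ENNReal.ofReal_le_one] at h
  rwa [div_le_one (by positivity)] at h

lemma tip_logbeta {x y : ℝ} (hx : 0 < x) (hy : 0 < y) :
    Real.log (ProbabilityTheory.beta x y) = Real.log (Real.Gamma x) + Real.log (Real.Gamma y)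
      - Real.log (Real.Gamma (x + y)) := by
  have h1 := Real.Gamma_pos_of_pos hx
  have h2 := Real.Gamma_pos_of_pos hy
  have h3 := Real.Gamma_pos_of_pos (add_pos hx hy)
  rw [ProbabilityTheory.beta, Real.log_div (by positivity) h3.ne', Real.log_mul h1.ne' h2.ne']

lemma tip_log_le {a b x y u v : ℝ} (ha : 0 < a) (hb : 0 < b) (hab : a + b = 1)
    (hx : 0 < x) (hy : 0 < y) (hu : 0 < u) (hv : 0 < v) :
    a * (Real.log (Real.Gamma (x + y)) - Real.log (Real.Gamma x) - Real.log (Real.Gamma y))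
    + b * (Real.log (Real.Gamma (u + v)) - Real.log (Real.Gamma u) - Real.log (Real.Gamma v))
    ≤ Real.log (Real.Gamma ((a * x + b * u) + (a * y + b * v)))
      - Real.log (Real.Gamma (a * x + b * u)) - Real.log (Real.Gamma (a * y + b * v)) := by
  have hz : 0 < a * x + b * u := by positivity
  have hw : 0 < a * y + b * v := by positivity
  have B1 := ProbabilityTheory.beta_pos hx hy
  have B2 := ProbabilityTheory.beta_pos hu hv
  have h := Real.log_le_log (ProbabilityTheory.beta_pos hz hw) (tip_beta_le ha hb hab hx hy hu hv)
  rw [Real.log_mul (by positivity) (by positivity), Real.log_rpow B1, Real.log_rpow B2,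
    tip_logbeta hx hy, tip_logbeta hu hv, tip_logbeta hz hw] at h
  linarith


/-- **Concavity of the TIP log-likelihood in the parameters.** With
`θ = (α₀, β₀, s, f, ŝ, f̂)`, cumulative experiences `α_k(θ) = α₀ + s·P_k + ŝ·Q_k` and
`β_k(θ) = β₀ + f·P̄_k + f̂·Q̄_k`, the log-likelihood
`H(θ) = Σ_k [log Γ(α_k+β_k) − log Γ(α_k) − log Γ(β_k)
  + (α_k−1)·log t_k + (β_k−1)·log(1−t_k)]`
is concave on the positive orthant. -/
theorem tip_logLikelihood_concaveOn
    (K : ℕ) (t P Pb Q Qb : ℕ → ℝ)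
    (ht : ∀ k ≤ K, t k ∈ Set.Ioo (0 : ℝ) 1)
    (hP : ∀ k ≤ K, 0 ≤ P k) (hPb : ∀ k ≤ K, 0 ≤ Pb k)
    (hQ : ∀ k ≤ K, 0 ≤ Q k) (hQb : ∀ k ≤ K, 0 ≤ Qb k) :
    ConcaveOn ℝ
      {θ : ℝ × ℝ × ℝ × ℝ × ℝ × ℝ |
        0 < θ.1 ∧ 0 < θ.2.1 ∧ 0 < θ.2.2.1 ∧ 0 < θ.2.2.2.1 ∧
          0 < θ.2.2.2.2.1 ∧ 0 < θ.2.2.2.2.2}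
      (fun θ : ℝ × ℝ × ℝ × ℝ × ℝ × ℝ =>
        ∑ k ∈ Finset.range (K + 1),
          (Real.log (Real.Gamma
              ((θ.1 + θ.2.2.1 * P k + θ.2.2.2.2.1 * Q k) +
                (θ.2.1 + θ.2.2.2.1 * Pb k + θ.2.2.2.2.2 * Qb k)))
            - Real.log (Real.Gamma (θ.1 + θ.2.2.1 * P k + θ.2.2.2.2.1 * Q k))
            - Real.log (Real.Gamma (θ.2.1 + θ.2.2.2.1 * Pb k + θ.2.2.2.2.2 * Qb k))
            + ((θ.1 + θ.2.2.1 * P k + θ.2.2.2.2.1 * Q k) - 1) * Real.log (t k)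
            + ((θ.2.1 + θ.2.2.2.1 * Pb k + θ.2.2.2.2.2 * Qb k) - 1)
                * Real.log (1 - t k))) := by
  refine concaveOn_iff_forall_pos.mpr ⟨?_, ?_⟩
  · rintro ⟨x1, x2, x3, x4, x5, x6⟩ ⟨h1, h2, h3, h4, h5, h6⟩
      ⟨y1, y2, y3, y4, y5, y6⟩ ⟨g1, g2, g3, g4, g5, g6⟩ a b ha hb hab
    dsimp only at h1 h2 h3 h4 h5 h6 g1 g2 g3 g4 g5 g6
    have key : ∀ p q : ℝ, 0 < p → 0 < q → 0 < a * p + b * q := by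
      intro p q hp hq
      rcases ha.eq_or_lt with rfl | ha
      · have : b = 1 := by linarith
        subst this; simpa using hq
      · positivity
    exact ⟨key _ _ h1 g1, key _ _ h2 g2, key _ _ h3 g3, key _ _ h4 g4, key _ _ h5 g5,
      key _ _ h6 g6⟩
  · rintro ⟨x1, x2, x3, x4, x5, x6⟩ ⟨h1, h2, h3, h4, h5, h6⟩
      ⟨y1, y2, y3, y4, y5, y6⟩ ⟨g1, g2, g3, g4, g5, g6⟩ a b ha hb hab
    dsimp only at h1 h2 h3 h4 h5 h6 g1 g2 g3 g4 g5 g6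
    simp only [smul_eq_mul, Prod.smul_mk, Prod.mk_add_mk]
    rw [Finset.mul_sum, Finset.mul_sum, ← Finset.sum_add_distrib]
    refine Finset.sum_le_sum fun k hk => ?_
    have hk : k ≤ K := by simpa [Nat.lt_succ_iff] using hk
    have p1 := hP k hk
    have p2 := hPb k hk
    have p3 := hQ k hk
    have p4 := hQb k hk
    have hA : 0 < x1 + x3 * P k + x5 * Q k := by positivity
    have hB : 0 < x2 + x4 * Pb k + x6 * Qb k := by positivity
    have hC : 0 < y1 + y3 * P k + y5 * Q k := by positivity
    have hD : 0 < y2 + y4 * Pb k + y6 * Qb k := by positivity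
    have h := tip_log_le ha hb hab hA hB hC hD
    have e1 : a * x1 + b * y1 + (a * x3 + b * y3) * P k + (a * x5 + b * y5) * Q k
        = a * (x1 + x3 * P k + x5 * Q k) + b * (y1 + y3 * P k + y5 * Q k) := by ring
    have e2 : a * x2 + b * y2 + (a * x4 + b * y4) * Pb k + (a * x6 + b * y6) * Qb k
        = a * (x2 + x4 * Pb k + x6 * Qb k) + b * (y2 + y4 * Pb k + y6 * Qb k) := by ring
    rw [e1, e2]
    have hb' : b = 1 - a := by linarith
    refine le_of_sub_nonneg (le_of_le_of_eq (sub_nonneg.mpr h) ?_)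
    linear_combination (Real.log (t k) + Real.log (1 - t k)) * (-hab)
end
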